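/- arXiv:2112.00456 — 7 statements merged into one kernel-verified Lean document; each statement's English description precedes it below -/
import Mathlib

section
/- Let S ⊆ ℝ^{n+1} be a finite union of sets, each of which is the solution set of a finite system of conditions of the form p = 0 or p > 0 with p ∈ ℝ[X_1,…,X_{n+1}]. Then the image of S under the projection ℝ^{n+1} → ℝ^n forgetting the last coordinate is again a finite union of solution sets of finite systems of conditions of the form q = 0 or q > 0 with q ∈ ℝ[X_1,…,X_n]. -/
/-- A basic semialgebraic set in `ℝ^n`: the solution set of a finite system of conditions
of the form `p = 0` or `p > 0` with `p ∈ ℝ[X_1, …, X_n]`. -/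
def IsBasicSemialgebraic (n : ℕ) (S : Set (Fin n → ℝ)) : Prop :=
  ∃ (k : ℕ) (p : Fin k → MvPolynomial (Fin n) ℝ) (strict : Fin k → Bool),
    S = {x | ∀ i, if strict i then 0 < MvPolynomial.eval x (p i)
                  else MvPolynomial.eval x (p i) = 0}

/-- A finite union of basic semialgebraic sets in `ℝ^n`. -/
def IsUnionOfBasicSemialgebraic (n : ℕ) (S : Set (Fin n → ℝ)) : Prop :=
  ∃ (m : ℕ) (T : Fin m → Set (Fin n → ℝ)),
    (∀ j, IsBasicSemialgebraic n (T j)) ∧ S = ⋃ j, T j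

open Filter Topology

section TS

def Cut (Z : Set ℝ) (y y' : ℝ) : Prop := ∀ z ∈ Z, (z < y ↔ z < y') ∧ (y < z ↔ y' < z)

lemma Cut.rfl' {Z : Set ℝ} (y : ℝ) : Cut Z y y := fun _ _ => ⟨Iff.rfl, Iff.rfl⟩
lemma Cut.symm {Z : Set ℝ} {a b : ℝ} (h : Cut Z a b) : Cut Z b a :=
  fun z hz => ⟨(h z hz).1.symm, (h z hz).2.symm⟩
lemma Cut.trans {Z : Set ℝ} {a b c : ℝ} (h : Cut Z a b) (h' : Cut Z b c) : Cut Z a c :=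
  fun z hz => ⟨(h z hz).1.trans (h' z hz).1, (h z hz).2.trans (h' z hz).2⟩
lemma Cut.eq_of_mem {Z : Set ℝ} {a b : ℝ} (h : Cut Z a b) (ha : a ∈ Z) : a = b := by
  have := h a ha
  simp only [lt_self_iff_false, false_iff, not_lt] at this
  exact le_antisymm this.2 this.1
lemma Cut.not_mem {Z : Set ℝ} {a b : ℝ} (h : Cut Z a b) (ha : a ∉ Z) : b ∉ Z := by
  intro hb
  exact ha (h.symm.eq_of_mem hb ▸ hb)
lemma Cut.between {Z : Set ℝ} {a b t : ℝ} (h : Cut Z a b) (h1 : a ≤ t) (h2 : t ≤ b) :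
    Cut Z a t := by
  intro z hz
  have := h z hz
  constructor
  · constructor
    · intro; linarith
    · intro h3; exact this.1.2 (by linarith)
  · constructor
    · intro h3; have := this.2.1 h3; linarith
    · intro; linarith
lemma cut_of_Ioo {Z : Set ℝ} {c d a b : ℝ} (h : ∀ z ∈ Z, z ∉ Set.Ioo c d)
    (ha : a ∈ Set.Ioo c d) (hb : b ∈ Set.Ioo c d) : Cut Z a b := by
  intro z hz
  have := h z hz
  simp only [Set.mem_Ioo, not_and, not_lt] at this ha hb
  rcases le_or_gt z c with h1 | h1
  · constructor <;> constructor <;> intro <;> linarith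
  · have := this h1
    constructor <;> constructor <;> intro <;> linarith
lemma Cut.no_mem {Z : Set ℝ} {a b : ℝ} (h : Cut Z a b) : ∀ z ∈ Z, z ∉ Set.Ioo a b := by
  intro z hz hm
  have := (h z hz).2.1 hm.1
  linarith [hm.2]

lemma bump_aux (c d u v : ℝ) (hc : c < u) (huv : u ≤ v) (hd : v < d) :
    ∃ k : ℝ ≃o ℝ, k u = v ∧ (∀ t, t ≤ c → k t = t) ∧ (∀ t, d ≤ t → k t = t) := by
  have hs1 : 1 ≤ (v - c) / (u - c) := by rw [le_div_iff₀ (by linarith)]; linarith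
  have hs2 : (d - v) / (d - u) ≤ 1 := by rw [div_le_iff₀ (by linarith)]; linarith
  have hs2' : 0 < (d - v) / (d - u) := div_pos (by linarith) (by linarith)
  have e1 : (u - c) * ((v - c) / (u - c)) = v - c := by
    have : u - c ≠ 0 := by linarith
    field_simp
  have e2 : (d - u) * ((d - v) / (d - u)) = d - v := by
    have : d - u ≠ 0 := by linarith
    field_simp
  set s1 := (v - c) / (u - c)
  set s2 := (d - v) / (d - u)
  let f : ℝ → ℝ := fun t => max t (min (c + (t - c) * s1) (d - (d - t) * s2))
  have hm : StrictMono f := by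
    intro a b hab
    have h1 : c + (a - c) * s1 < c + (b - c) * s1 := by nlinarith
    have h2 : d - (d - a) * s2 < d - (d - b) * s2 := by nlinarith
    exact max_lt_max hab (min_lt_min h1 h2)
  have hfc : ∀ t, t ≤ c → f t = t := by
    intro t ht
    apply max_eq_left
    apply min_le_of_left_le
    nlinarith
  have hfd : ∀ t, d ≤ t → f t = t := by
    intro t ht
    apply max_eq_left
    apply min_le_of_right_le
    nlinarith
  have hcont : Continuous f := by fun_prop
  have hsurj : Function.Surjective f := by
    apply hcont.surjective
    · apply tendsto_atTop_mono (f := fun t => t) (fun t => le_max_left _ _) tendsto_id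
    · apply tendsto_id.congr'
      filter_upwards [eventually_le_atBot c] with t ht
      exact (hfc t ht).symm
  refine ⟨hm.orderIsoOfSurjective f hsurj, ?_, hfc, hfd⟩
  change f u = v
  simp only [f]
  rw [e1, e2]
  simp [huv]

lemma bump (c d u v : ℝ) (hu : u ∈ Set.Ioo c d) (hv : v ∈ Set.Ioo c d) :
    ∃ k : ℝ ≃o ℝ, k u = v ∧ (∀ t, t ≤ c → k t = t) ∧ (∀ t, d ≤ t → k t = t) := by
  rcases le_total u v with h | h
  · exact bump_aux c d u v hu.1 h hv.2
  · obtain ⟨k, h1, h2, h3⟩ := bump_aux c d v u hv.1 h hu.2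
    refine ⟨k.symm, ?_, ?_, ?_⟩
    · rw [← h1]; simp
    · intro t ht; rw [OrderIso.symm_apply_eq, h2 t ht]
    · intro t ht; rw [OrderIso.symm_apply_eq, h3 t ht]

lemma exists_right {Z : Set ℝ} (hZ : Z.Finite) (u : ℝ) (hu : u ∉ Z) :
    ∃ d > u, ∀ z ∈ Z, z ∉ Set.Ico u d := by
  have : Zᶜ ∈ 𝓝[≥] u := mem_nhdsWithin_of_mem_nhds (hZ.isClosed.isOpen_compl.mem_nhds hu)
  obtain ⟨d, hd, h⟩ := (mem_nhdsGE_iff_exists_Ico_subset).1 this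
  exact ⟨d, hd, fun z hz hm => h hm hz⟩

lemma exists_left {Z : Set ℝ} (hZ : Z.Finite) (u : ℝ) (hu : u ∉ Z) :
    ∃ d < u, ∀ z ∈ Z, z ∉ Set.Ioc d u := by
  have : Zᶜ ∈ 𝓝[≤] u := mem_nhdsWithin_of_mem_nhds (hZ.isClosed.isOpen_compl.mem_nhds hu)
  obtain ⟨d, hd, h⟩ := (mem_nhdsLE_iff_exists_Ioc_subset).1 this
  exact ⟨d, hd, fun z hz hm => h hm hz⟩

lemma exists_Ioo_of_cut {Z : Set ℝ} (hZ : Z.Finite) {u v : ℝ} (huv : Cut Z u v) (hu : u ∉ Z) :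
    ∃ c d, u ∈ Set.Ioo c d ∧ v ∈ Set.Ioo c d ∧ ∀ z ∈ Z, z ∉ Set.Ioo c d := by
  wlog h : u ≤ v generalizing u v
  · obtain ⟨c, d, h1, h2, h3⟩ := this huv.symm (huv.not_mem hu) (by linarith)
    exact ⟨c, d, h2, h1, h3⟩
  obtain ⟨c, hc, hc'⟩ := exists_left hZ u hu
  obtain ⟨d, hd, hd'⟩ := exists_right hZ v (huv.not_mem hu)
  refine ⟨c, d, ⟨hc, by linarith⟩, ⟨by linarith, hd⟩, fun z hz hm => ?_⟩
  rcases le_or_gt z u with h1 | h1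
  · exact hc' z hz ⟨hm.1, h1⟩
  rcases le_or_gt v z with h2 | h2
  · exact hd' z hz ⟨h2, hm.2⟩
  exact huv.no_mem z hz ⟨h1, h2⟩

lemma bump_cut {Z : Set ℝ} (hZ : Z.Finite) {u v : ℝ} (huv : Cut Z u v) (hu : u ∉ Z) :
    ∃ k : ℝ ≃o ℝ, k u = v ∧ (∀ y, Cut Z (k y) y) ∧ ∀ y, ¬ Cut Z u y → k y = y := by
  obtain ⟨c, d, h1, h2, h3⟩ := exists_Ioo_of_cut hZ huv hu
  obtain ⟨k, k1, k2, k3⟩ := bump c d u v h1 h2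
  have key : ∀ y, y ∉ Set.Ioo c d → k y = y := by
    intro y hy
    rcases le_or_gt y c with h | h
    · exact k2 y h
    · exact k3 y (by by_contra h'; exact hy ⟨h, by linarith⟩)
  refine ⟨k, k1, fun y => ?_, fun y hy => ?_⟩
  · by_cases hy : y ∈ Set.Ioo c d
    · refine cut_of_Ioo h3 ⟨?_, ?_⟩ hy
      · rw [← k2 c le_rfl]; exact k.strictMono hy.1
      · rw [← k3 d le_rfl]; exact k.strictMono hy.2
    · rw [key y hy]; exact Cut.rfl' y
  · exact key y fun h => hy (cut_of_Ioo h3 h1 h)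

structure Setup (Z : Set ℝ) (p f : ℝ → ℝ) : Prop where
  fin : Z.Finite
  cp : Continuous p
  cf : Continuous f
  sgn : ∀ z ∈ Z, SignType.sign (p z) = SignType.sign (f z)
  top : ∀ᶠ t in atTop, SignType.sign (p t) = SignType.sign (f t)
  bot : ∀ᶠ t in atBot, SignType.sign (p t) = SignType.sign (f t)
  mono : ∀ a b, (∀ z ∈ Z, z ∉ Set.Ioo a b) →
    (StrictMonoOn p (Set.Icc a b) ∧ StrictMonoOn f (Set.Icc a b)) ∨
    (StrictAntiOn p (Set.Icc a b) ∧ StrictAntiOn f (Set.Icc a b))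

lemma Setup.swap {Z : Set ℝ} {p f : ℝ → ℝ} (S : Setup Z p f) : Setup Z f p where
  fin := S.fin
  cp := S.cf
  cf := S.cp
  sgn := fun z hz => (S.sgn z hz).symm
  top := S.top.mono fun _ h => h.symm
  bot := S.bot.mono fun _ h => h.symm
  mono := fun a b h => (S.mono a b h).imp And.symm And.symm

lemma Setup.neg {Z : Set ℝ} {p f : ℝ → ℝ} (S : Setup Z p f) :
    Setup Z (fun t => - p t) (fun t => - f t) where
  fin := S.fin
  cp := S.cp.neg
  cf := S.cf.neg
  sgn := fun z hz => by rw [Left.sign_neg, Left.sign_neg, S.sgn z hz]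
  top := S.top.mono fun _ h => by rw [Left.sign_neg, Left.sign_neg, h]
  bot := S.bot.mono fun _ h => by rw [Left.sign_neg, Left.sign_neg, h]
  mono := fun a b h => (S.mono a b h).symm.imp
    (fun h => ⟨h.1.neg, h.2.neg⟩) (fun h => ⟨h.1.neg, h.2.neg⟩)

lemma Setup.exR {Z : Set ℝ} {p f : ℝ → ℝ} (S : Setup Z p f) (y : ℝ) :
    ∃ b > y, (∀ z ∈ Z, z ∉ Set.Ioo y b) ∧ SignType.sign (p b) = SignType.sign (f b) := by
  by_cases h : (Z ∩ Set.Ioi y).Nonempty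
  · obtain ⟨b, hb, hmin⟩ := (S.fin.inter_of_left (Set.Ioi y)).exists_minimal h
    refine ⟨b, hb.2, fun z hz hm => ?_, S.sgn b hb.1⟩
    have := hmin ⟨hz, hm.1⟩ hm.2.le
    linarith [hm.2]
  · obtain ⟨b, h1, h2⟩ := (S.top.and (eventually_gt_atTop y)).exists
    exact ⟨b, h2, fun z hz hm => h ⟨z, hz, hm.1⟩, h1⟩

lemma Setup.exL {Z : Set ℝ} {p f : ℝ → ℝ} (S : Setup Z p f) (y : ℝ) :
    ∃ b < y, (∀ z ∈ Z, z ∉ Set.Ioo b y) ∧ SignType.sign (p b) = SignType.sign (f b) := by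
  by_cases h : (Z ∩ Set.Iio y).Nonempty
  · obtain ⟨b, hb, hmin⟩ := (S.fin.inter_of_left (Set.Iio y)).exists_maximal h
    refine ⟨b, hb.2, fun z hz hm => ?_, S.sgn b hb.1⟩
    have := hmin ⟨hz, hm.2⟩ hm.1.le
    linarith [hm.1]
  · obtain ⟨b, h1, h2⟩ := (S.bot.and (eventually_lt_atBot y)).exists
    exact ⟨b, h2, fun z hz hm => h ⟨z, hz, hm.2⟩, h1⟩

lemma Setup.pos {Z : Set ℝ} {p f : ℝ → ℝ} (S : Setup Z p f) {y : ℝ} (hy : y ∉ Z)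
    (hp : 0 < p y) : ∃ t, Cut Z y t ∧ 0 < f t := by
  obtain ⟨b, hb, hb1, hb2⟩ := S.exR y
  obtain ⟨a, ha, ha1, ha2⟩ := S.exL y
  have hab : ∀ z ∈ Z, z ∉ Set.Ioo a b := by
    intro z hz hm
    rcases lt_trichotomy z y with h | h | h
    · exact ha1 z hz ⟨hm.1, h⟩
    · exact hy (h ▸ hz)
    · exact hb1 z hz ⟨h, hm.2⟩
  rcases S.mono a b hab with ⟨h1, h2⟩ | ⟨h1, h2⟩
  · have : 0 < p b := hp.trans (h1 ⟨ha.le, hb.le⟩ ⟨by linarith, le_rfl⟩ hb)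
    have hfb : 0 < f b := by
      rw [sign_pos this] at hb2
      exact sign_eq_one_iff.1 hb2.symm
    have e1 : ∀ᶠ t in 𝓝[<] b, 0 < f t :=
      (S.cf.continuousAt.eventually (lt_mem_nhds hfb)).filter_mono nhdsWithin_le_nhds
    have e2 : ∀ᶠ t in 𝓝[<] b, t ∈ Set.Ioo y b := Ioo_mem_nhdsLT hb
    obtain ⟨t, t1, t2⟩ := (e1.and e2).exists
    exact ⟨t, cut_of_Ioo hab ⟨ha, hb⟩ ⟨ha.trans t2.1, t2.2⟩, t1⟩
  · have : 0 < p a := hp.trans (h1 ⟨le_rfl, by linarith⟩ ⟨ha.le, hb.le⟩ ha)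
    have hfb : 0 < f a := by
      rw [sign_pos this] at ha2
      exact sign_eq_one_iff.1 ha2.symm
    have e1 : ∀ᶠ t in 𝓝[>] a, 0 < f t :=
      (S.cf.continuousAt.eventually (lt_mem_nhds hfb)).filter_mono nhdsWithin_le_nhds
    have e2 : ∀ᶠ t in 𝓝[>] a, t ∈ Set.Ioo a y := Ioo_mem_nhdsGT ha
    obtain ⟨t, t1, t2⟩ := (e1.and e2).exists
    exact ⟨t, cut_of_Ioo hab ⟨ha, hb⟩ ⟨t2.1, t2.2.trans hb⟩, t1⟩

lemma Setup.negv {Z : Set ℝ} {p f : ℝ → ℝ} (S : Setup Z p f) {y : ℝ} (hy : y ∉ Z)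
    (hp : p y < 0) : ∃ t, Cut Z y t ∧ f t < 0 := by
  obtain ⟨t, h1, h2⟩ := S.neg.pos hy (by simpa using hp)
  exact ⟨t, h1, by simpa using h2⟩

lemma ivt_cut {Z : Set ℝ} {f : ℝ → ℝ} (hf : Continuous f) {a b : ℝ} (h : Cut Z a b)
    (ha : f a < 0) (hb : 0 < f b) : ∃ t, Cut Z a t ∧ f t = 0 := by
  have h0 : (0:ℝ) ∈ Set.Icc (f a) (f b) := ⟨ha.le, hb.le⟩
  obtain ⟨t, ht, h0⟩ := intermediate_value_uIcc (f := f) hf.continuousOn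
    (Set.Icc_subset_uIcc h0)
  refine ⟨t, ?_, h0⟩
  rcases Set.mem_uIcc.1 ht with ⟨h1, h2⟩ | ⟨h1, h2⟩
  · exact h.between h1 h2
  · exact h.trans (h.symm.between h1 h2)

lemma Setup.uniq {Z : Set ℝ} {p f : ℝ → ℝ} (S : Setup Z p f) {a b : ℝ} (h : Cut Z a b)
    (ha : p a = 0) (hb : p b = 0) : a = b := by
  wlog hab : a ≤ b generalizing a b
  · exact (this h.symm hb ha (by linarith)).symm
  rcases S.mono a b h.no_mem with h | h
  · exact h.1.injOn ⟨le_rfl, hab⟩ ⟨hab, le_rfl⟩ (by rw [ha, hb])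
  · exact h.1.injOn ⟨le_rfl, hab⟩ ⟨hab, le_rfl⟩ (by rw [ha, hb])

lemma Setup.zero {Z : Set ℝ} {p f : ℝ → ℝ} (S : Setup Z p f) {y : ℝ} (hy : y ∉ Z)
    (hp : p y = 0) : ∃ t, Cut Z y t ∧ f t = 0 := by
  obtain ⟨c, d, h1, -, h3⟩ := exists_Ioo_of_cut S.fin (Cut.rfl' y) hy
  obtain ⟨a, ha1, ha2⟩ := exists_between h1.1
  obtain ⟨b, hb1, hb2⟩ := exists_between h1.2
  have ca : Cut Z y a := cut_of_Ioo h3 h1 ⟨ha1, by linarith [h1.2]⟩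
  have cb : Cut Z y b := cut_of_Ioo h3 h1 ⟨by linarith [h1.1], hb2⟩
  have : ∃ l r, Cut Z y l ∧ Cut Z y r ∧ p l < 0 ∧ 0 < p r := by
    have ma : a ∈ Set.Icc a b := ⟨le_rfl, by linarith⟩
    have my : y ∈ Set.Icc a b := ⟨by linarith, by linarith⟩
    have mb : b ∈ Set.Icc a b := ⟨by linarith, by linarith⟩
    rcases S.mono a b (ca.symm.trans cb).no_mem with h | h
    · exact ⟨a, b, ca, cb, hp ▸ h.1 ma my ha2, hp ▸ h.1 my mb hb1⟩
    · exact ⟨b, a, cb, ca, hp ▸ h.1 my mb hb1, hp ▸ h.1 ma my ha2⟩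
  obtain ⟨l, r, hl, hr, hl', hr'⟩ := this
  obtain ⟨t, t1, t2⟩ := S.negv (hl.not_mem hy) hl'
  obtain ⟨s, s1, s2⟩ := S.pos (hr.not_mem hy) hr'
  obtain ⟨w, w1, w2⟩ := ivt_cut S.cf (((hl.trans t1).symm.trans hr).trans s1) t2 s2
  exact ⟨w, (hl.trans t1).trans w1, w2⟩

lemma Setup.sew {Z : Set ℝ} {p f : ℝ → ℝ} (S : Setup Z p f) {W : Set ℝ} (hW : W.Finite) :
    (∀ w ∈ W, w ∉ Z ∧ p w = 0) → ∃ k : ℝ ≃o ℝ, (∀ y, Cut Z (k y) y) ∧ ∀ w ∈ W, f (k w) = 0 := by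
  induction W, hW using Set.Finite.induction_on with
  | empty => exact fun _ => ⟨OrderIso.refl ℝ, fun y => Cut.rfl' y, by simp⟩
  | @insert w W hw _ ih =>
    intro hI
    obtain ⟨k, k1, k2⟩ := ih fun w hw => hI w (Set.mem_insert_of_mem _ hw)
    obtain ⟨wZ, w0⟩ := hI w (Set.mem_insert _ _)
    obtain ⟨v, hv, hv0⟩ := S.zero wZ w0
    obtain ⟨β, b1, b2, b3⟩ := bump_cut S.fin ((k1 w).trans hv) ((k1 w).symm.not_mem wZ)
    refine ⟨k.trans β, fun y => (b2 _).trans (k1 y), ?_⟩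
    rintro t (rfl | ht)
    · simp [b1, hv0]
    · have : β (k t) = k t := by
        apply b3
        intro hc
        have := S.uniq ((k1 w).symm.trans (hc.trans (k1 t))) w0 (hI t (Set.mem_insert_of_mem _ ht)).2
        exact hw (this ▸ ht)
      simp [this, k2 t ht]

lemma Setup.main {Z : Set ℝ} {p f : ℝ → ℝ} (S : Setup Z p f) (hp : {t | p t = 0}.Finite) :
    ∃ k : ℝ ≃o ℝ, (∀ y, Cut Z (k y) y) ∧
      ∀ y, SignType.sign (p y) = SignType.sign (f (k y)) := by
  obtain ⟨k, k1, k2⟩ := S.sew (hp.sdiff (t := Z)) (fun w hw => ⟨hw.2, hw.1⟩)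
  refine ⟨k, k1, fun y => ?_⟩
  by_cases hy : y ∈ Z
  · rw [← (k1 y).symm.eq_of_mem hy]; exact S.sgn y hy
  by_cases hw : ∃ w, Cut Z y w ∧ p w = 0
  · obtain ⟨w, hyw, w0⟩ := hw
    have fk := k2 w ⟨w0, hyw.not_mem hy⟩
    rcases lt_trichotomy y w with h | rfl | h
    · obtain ⟨c, d, h1, h2, h3⟩ := exists_Ioo_of_cut S.fin hyw hy
      have hk : k y < k w := k.strictMono h
      have hcut : Cut Z (k y) (k w) := (k1 y).trans (hyw.trans (k1 w).symm)
      have ck : Cut Z (min y (k y)) (max w (k w)) := by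
        rcases min_choice y (k y) with e | e <;> rcases max_choice w (k w) with e' | e' <;>
          rw [e, e']
        · exact hyw
        · exact hyw.trans (k1 w).symm
        · exact (k1 y).trans hyw
        · exact hcut
      have m1 : y ∈ Set.Icc (min y (k y)) (max w (k w)) := by simp [h.le]
      have m2 : w ∈ Set.Icc (min y (k y)) (max w (k w)) := by simp [h.le]
      have m3 : k y ∈ Set.Icc (min y (k y)) (max w (k w)) := by simp [h.le]
      have m4 : k w ∈ Set.Icc (min y (k y)) (max w (k w)) := by simp [h.le]
      rcases S.mono _ _ ck.no_mem with g | g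
      · have a1 := g.1 m1 m2 h
        have a2 := g.2 m3 m4 hk
        rw [w0] at a1; rw [fk] at a2
        rw [sign_neg a1, sign_neg a2]
      · have a1 := g.1 m1 m2 h
        have a2 := g.2 m3 m4 hk
        rw [w0] at a1; rw [fk] at a2
        rw [sign_pos a1, sign_pos a2]
    · rw [w0, fk]
    · have hk : k w < k y := k.strictMono h
      have hcut : Cut Z (k w) (k y) := ((k1 y).trans (hyw.trans (k1 w).symm)).symm
      have ck : Cut Z (min w (k w)) (max y (k y)) := by
        rcases min_choice w (k w) with e | e <;> rcases max_choice y (k y) with e' | e' <;>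
          rw [e, e']
        · exact hyw.symm
        · exact ((k1 y).trans hyw).symm
        · exact (hyw.trans (k1 w).symm).symm
        · exact hcut
      have m1 : y ∈ Set.Icc (min w (k w)) (max y (k y)) := by simp [h.le]
      have m2 : w ∈ Set.Icc (min w (k w)) (max y (k y)) := by simp [h.le]
      have m3 : k y ∈ Set.Icc (min w (k w)) (max y (k y)) := by simp [h.le]
      have m4 : k w ∈ Set.Icc (min w (k w)) (max y (k y)) := by simp [h.le]
      rcases S.mono _ _ ck.no_mem with g | g
      · have a1 := g.1 m2 m1 h
        have a2 := g.2 m4 m3 hk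
        rw [w0] at a1; rw [fk] at a2
        rw [sign_pos a1, sign_pos a2]
      · have a1 := g.1 m2 m1 h
        have a2 := g.2 m4 m3 hk
        rw [w0] at a1; rw [fk] at a2
        rw [sign_neg a1, sign_neg a2]
  · push Not at hw
    have hky : k y ∉ Z := (k1 y).symm.not_mem hy
    have hf0 : f (k y) ≠ 0 := by
      intro h0
      obtain ⟨t, t1, t2⟩ := S.swap.zero hky h0
      exact hw t ((k1 y).symm.trans t1) t2
    rcases lt_or_gt_of_ne (hw y (Cut.rfl' y)) with h | h <;> rcases lt_or_gt_of_ne hf0 with h' | h'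
    · rw [sign_neg h, sign_neg h']
    · obtain ⟨t, t1, t2⟩ := S.swap.pos hky h'
      obtain ⟨s, s1, s2⟩ := ivt_cut S.cp ((k1 y).symm.trans t1) h t2
      exact absurd s2 (hw s s1)
    · obtain ⟨t, t1, t2⟩ := S.swap.negv hky h'
      have ht := (k1 y).symm.trans t1
      obtain ⟨s, s1, s2⟩ := ivt_cut S.cp ht.symm t2 h
      exact absurd s2 (hw s (ht.trans s1))
    · rw [sign_pos h, sign_pos h']

end TS

section TS2
open Polynomial

lemma ev_sign_top (p : ℝ[X]) :
    ∀ᶠ y in atTop, SignType.sign (p.eval y) = SignType.sign p.leadingCoeff := by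
  rcases le_or_gt p.degree 0 with h | h
  · rw [eq_C_of_degree_le_zero h]; simp
  · have h0 : p ≠ 0 := by rintro rfl; simp at h
    rcases lt_or_gt_of_ne (leadingCoeff_ne_zero.2 h0) with h1 | h1
    · filter_upwards [(p.tendsto_atBot_of_leadingCoeff_nonpos h h1.le).eventually_lt_atBot 0] with y hy
      rw [sign_neg hy, sign_neg h1]
    · filter_upwards [(p.tendsto_atTop_of_leadingCoeff_nonneg h h1.le).eventually_gt_atTop 0] with y hy
      rw [sign_pos hy, sign_pos h1]

lemma ev_deriv_top (p : ℝ[X]) (hp : derivative p ≠ 0) :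
    ∀ᶠ y in atTop, SignType.sign (p.eval y) = SignType.sign ((derivative p).eval y) := by
  filter_upwards [ev_sign_top p, ev_sign_top (derivative p)] with y h1 h2
  rw [h1, h2, leadingCoeff_derivative, sign_mul]
  have : 0 < (p.natDegree : ℝ) := by
    have : p.natDegree ≠ 0 := fun h => hp (derivative_of_natDegree_zero h)
    positivity
  rw [sign_pos this, mul_one]

lemma ev_deriv_bot (p : ℝ[X]) (hp : derivative p ≠ 0) :
    ∀ᶠ y in atBot, SignType.sign (p.eval y) = - SignType.sign ((derivative p).eval y) := by
  have hd : derivative (p.comp (-X)) = - (derivative p).comp (-X) := by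
    rw [derivative_comp]; simp
  have h := ev_deriv_top (p.comp (-X)) (by
    rw [hd]
    intro h
    apply hp
    have h2 := congrArg (fun r : ℝ[X] => (-r).comp (-X)) h
    simpa [comp_assoc] using h2)
  have h2 := tendsto_neg_atBot_atTop.eventually h
  filter_upwards [h2] with y hy
  rw [hd] at hy
  simpa [Left.sign_neg] using hy

lemma const_sign {f : ℝ → ℝ} (hf : Continuous f) {a b : ℝ} (h : ∀ t ∈ Set.Ioo a b, f t ≠ 0) :
    (∀ t ∈ Set.Ioo a b, 0 < f t) ∨ (∀ t ∈ Set.Ioo a b, f t < 0) := by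
  by_contra! hc
  obtain ⟨⟨s, hs, hs'⟩, ⟨t, ht, ht'⟩⟩ := hc
  obtain ⟨r, hr, hr0⟩ := isPreconnected_Ioo.intermediate_value hs ht hf.continuousOn ⟨hs', ht'⟩
  exact h r hr hr0

lemma poly_setup (p q : ℝ[X]) (h : ℝ ≃o ℝ) (Z : Set ℝ) (hZ : Z.Finite)
    (hp : derivative p ≠ 0) (hq : derivative q ≠ 0)
    (hd : ∀ y, SignType.sign ((derivative p).eval y) = SignType.sign ((derivative q).eval (h y)))
    (hr : ∀ y, (derivative p).eval y = 0 → y ∈ Z)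
    (hs : ∀ z ∈ Z, SignType.sign (p.eval z) = SignType.sign (q.eval (h z))) :
    Setup Z (fun t => p.eval t) (fun t => q.eval (h t)) where
  fin := hZ
  cp := p.continuous
  cf := q.continuous.comp h.continuous
  sgn := hs
  top := by
    filter_upwards [ev_deriv_top p hp, h.tendsto_atTop.eventually (ev_deriv_top q hq)] with t h1 h2
    rw [h1, h2, hd]
  bot := by
    filter_upwards [ev_deriv_bot p hp, h.tendsto_atBot.eventually (ev_deriv_bot q hq)] with t h1 h2
    rw [h1, h2, hd]
  mono := by
    intro a b hab
    have hmem : ∀ s ∈ Set.Ioo (h a) (h b), h.symm s ∈ Set.Ioo a b := by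
      intro s hs
      exact ⟨by rw [h.lt_symm_apply]; exact hs.1, by rw [h.symm_apply_lt]; exact hs.2⟩
    have hmap : Set.MapsTo h (Set.Icc a b) (Set.Icc (h a) (h b)) := fun t ht =>
      ⟨h.monotone ht.1, h.monotone ht.2⟩
    rcases const_sign (derivative p).continuous (a := a) (b := b)
      (fun t ht h0 => hab t (hr t h0) ht) with g | g
    · left
      constructor
      · apply strictMonoOn_of_deriv_pos (convex_Icc a b) p.continuous.continuousOn
        intro t ht
        rw [interior_Icc] at ht
        rw [Polynomial.deriv]; exact g t ht
      · have : StrictMonoOn (fun t => q.eval t) (Set.Icc (h a) (h b)) := by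
          apply strictMonoOn_of_deriv_pos (convex_Icc _ _) q.continuous.continuousOn
          intro t ht
          rw [interior_Icc] at ht
          rw [Polynomial.deriv]
          have := hd (h.symm t)
          rw [sign_pos (g _ (hmem t ht))] at this
          simpa using sign_eq_one_iff.1 this.symm
        exact this.comp (h.strictMono.strictMonoOn _) hmap
    · right
      constructor
      · apply strictAntiOn_of_deriv_neg (convex_Icc a b) p.continuous.continuousOn
        intro t ht
        rw [interior_Icc] at ht
        rw [Polynomial.deriv]; exact g t ht
      · have : StrictAntiOn (fun t => q.eval t) (Set.Icc (h a) (h b)) := by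
          apply strictAntiOn_of_deriv_neg (convex_Icc _ _) q.continuous.continuousOn
          intro t ht
          rw [interior_Icc] at ht
          rw [Polynomial.deriv]
          have := hd (h.symm t)
          rw [sign_neg (g _ (hmem t ht))] at this
          simpa using sign_eq_neg_one_iff.1 this.symm
        exact this.comp_strictMonoOn (h.strictMono.strictMonoOn _) hmap

lemma sign_const_cut {Z : Set ℝ} {f : ℝ → ℝ} (hf : Continuous f) (hr : ∀ y, f y = 0 → y ∈ Z)
    {a b : ℝ} (h : Cut Z a b) : SignType.sign (f a) = SignType.sign (f b) := by
  by_cases ha : a ∈ Z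
  · rw [h.eq_of_mem ha]
  have key : ∀ t, Cut Z a t → f t ≠ 0 := fun t ht h0 => ht.not_mem ha (hr t h0)
  rcases lt_or_gt_of_ne (key a (Cut.rfl' a)) with h1 | h1 <;>
    rcases lt_or_gt_of_ne (key b h) with h2 | h2
  · rw [sign_neg h1, sign_neg h2]
  · obtain ⟨t, t1, t2⟩ := ivt_cut hf h h1 h2
    exact absurd t2 (key t t1)
  · obtain ⟨t, t1, t2⟩ := ivt_cut hf h.symm h2 h1
    exact absurd t2 (key t (h.trans t1))
  · rw [sign_pos h1, sign_pos h2]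

lemma pseudo_div {R : Type*} [CommRing R] (Q : R[X]) (m : ℕ) (hQ : ∀ i > m, Q.coeff i = 0)
    (k : ℕ) : ∀ P : R[X], (∀ i ≥ k, P.coeff i = 0) →
    ∃ (e : ℕ) (A r : R[X]), C (Q.coeff m) ^ e * P = A * Q + r ∧ ∀ i ≥ m, r.coeff i = 0 := by
  induction k with
  | zero => exact fun P hP => ⟨0, 0, P, by simp, fun i _ => hP i (by omega)⟩
  | succ k ih =>
    intro P hP
    rcases lt_or_ge k m with h | h
    · exact ⟨0, 0, P, by simp, fun i _ => hP i (by omega)⟩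
    · obtain ⟨e, A, r, h1, h2⟩ := ih (C (Q.coeff m) * P - C (P.coeff k) * (Q * X ^ (k - m))) (by
        intro i hi
        rw [coeff_sub, coeff_C_mul, coeff_C_mul, coeff_mul_X_pow', if_pos (by omega)]
        rcases eq_or_lt_of_le hi with rfl | hi
        · rw [show k - (k - m) = m by omega]; ring
        · rw [hP i (by omega), hQ (i - (k - m)) (by omega)]; ring)
      refine ⟨e + 1, A + C (Q.coeff m) ^ e * C (P.coeff k) * X ^ (k - m), r, ?_, h2⟩
      linear_combination h1

variable {n : ℕ}

/-- truncation -/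
noncomputable def tr {R : Type*} [CommRing R] (j : ℕ) (Q : R[X]) : R[X] :=
  ∑ i ∈ Finset.range (j + 1), C (Q.coeff i) * X ^ i

lemma tr_coeff {R : Type*} [CommRing R] (j : ℕ) (Q : R[X]) (i : ℕ) :
    (tr j Q).coeff i = if i ≤ j then Q.coeff i else 0 := by
  simp [tr, coeff_X_pow, Nat.lt_succ_iff]

lemma exists_rem {R : Type*} [CommRing R] (P Q : R[X]) (j : ℕ) :
    ∃ r : R[X], (∃ (e : ℕ) (A : R[X]), C (Q.coeff j) ^ e * P = A * tr j Q + r) ∧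
      ∀ i ≥ j, r.coeff i = 0 := by
  obtain ⟨e, A, r, h1, h2⟩ := pseudo_div (tr j Q) j
    (fun i hi => by rw [tr_coeff, if_neg (by omega)]) (P.natDegree + 1) P
    (fun i hi => coeff_eq_zero_of_natDegree_lt (by omega))
  rw [tr_coeff, if_pos le_rfl] at h1
  exact ⟨r, ⟨e, A, h1⟩, h2⟩

noncomputable def rm {R : Type*} [CommRing R] (P Q : R[X]) (j : ℕ) : R[X] :=
  (exists_rem P Q j).choose

lemma rm_spec {R : Type*} [CommRing R] (P Q : R[X]) (j : ℕ) :
    ∃ (e : ℕ) (A : R[X]), C (Q.coeff j) ^ e * P = A * tr j Q + rm P Q j :=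
  (exists_rem P Q j).choose_spec.1

lemma rm_deg {R : Type*} [CommRing R] (P Q : R[X]) (j : ℕ) :
    ∀ i ≥ j, (rm P Q j).coeff i = 0 := (exists_rem P Q j).choose_spec.2

/-- the specialization -/
noncomputable def sp (x : Fin n → ℝ) (P : (MvPolynomial (Fin n) ℝ)[X]) : ℝ[X] :=
  P.map (MvPolynomial.eval x)

def SameSign (F : Set (MvPolynomial (Fin n) ℝ)) (x x' : Fin n → ℝ) : Prop :=
  ∀ c ∈ F, SignType.sign (MvPolynomial.eval x c) = SignType.sign (MvPolynomial.eval x' c)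

def Equi (L : Set (MvPolynomial (Fin n) ℝ)[X]) (x x' : Fin n → ℝ) : Prop :=
  ∃ h : ℝ ≃o ℝ, ∀ P ∈ L, ∀ y, SignType.sign ((sp x P).eval y) = SignType.sign ((sp x' P).eval (h y))

def Good (L : Set (MvPolynomial (Fin n) ℝ)[X]) : Prop :=
  ∃ F : Set (MvPolynomial (Fin n) ℝ), F.Finite ∧ ∀ x x', SameSign F x x' → Equi L x x'

lemma sp_tr (x : Fin n → ℝ) (Q : (MvPolynomial (Fin n) ℝ)[X]) (j : ℕ)
    (h : ∀ i > j, MvPolynomial.eval x (Q.coeff i) = 0) : sp x (tr j Q) = sp x Q := by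
  ext i
  simp only [sp, coeff_map, tr_coeff]
  split_ifs with hi
  · rfl
  · rw [h i (by omega), map_zero]

lemma rm_eval (x : Fin n → ℝ) (P Q : (MvPolynomial (Fin n) ℝ)[X]) (j e : ℕ)
    (A : (MvPolynomial (Fin n) ℝ)[X]) (he : C (Q.coeff j) ^ e * P = A * tr j Q + rm P Q j)
    (h : ∀ i > j, MvPolynomial.eval x (Q.coeff i) = 0) (z : ℝ) (hz : (sp x Q).eval z = 0) :
    MvPolynomial.eval x (Q.coeff j) ^ e * (sp x P).eval z = (sp x (rm P Q j)).eval z := by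
  have h1 := congrArg (fun r => (sp x r).eval z) he
  have h2 := sp_tr x Q j h
  simp only [sp, Polynomial.map_mul, Polynomial.map_pow, Polynomial.map_add, map_C, eval_mul,
    eval_pow, eval_C, eval_add] at h1 h2 hz ⊢
  rw [h1, h2, hz]; ring

lemma step (P : (MvPolynomial (Fin n) ℝ)[X]) (K K' : Set (MvPolynomial (Fin n) ℝ)[X])
    (hK : K.Finite) (hK' : K' = insert (derivative P) K) (D : ℕ)
    (hD : ∀ Q ∈ K', ∀ i > D, Q.coeff i = 0)
    (hG : Good (K' ∪ (fun a : (MvPolynomial (Fin n) ℝ)[X] × ℕ => rm P a.1 a.2) ''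
      (K' ×ˢ Set.Iic D))) : Good (insert P K) := by
  obtain ⟨F, hF, hFE⟩ := hG
  have hK'f : K'.Finite := hK' ▸ hK.insert _
  refine ⟨F ∪ ({P.coeff 0} ∪ (fun a : (MvPolynomial (Fin n) ℝ)[X] × ℕ => a.1.coeff a.2) ''
      (K' ×ˢ Set.Iic D)), hF.union ((Set.finite_singleton _).union
        ((hK'f.prod (Set.finite_Iic D)).image _)), fun x x' hx => ?_⟩
  obtain ⟨h, hh⟩ := hFE x x' fun c hc => hx c (Or.inl hc)
  have hP0 := hx (P.coeff 0) (Or.inr (Or.inl rfl))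
  have hco : ∀ Q ∈ K', ∀ j, SignType.sign (MvPolynomial.eval x (Q.coeff j)) =
      SignType.sign (MvPolynomial.eval x' (Q.coeff j)) := by
    intro Q hQ j
    rcases le_or_gt j D with hj | hj
    · exact hx _ (Or.inr (Or.inr ⟨(Q, j), ⟨hQ, hj⟩, rfl⟩))
    · rw [hD Q hQ j hj]; simp
  have hhK : ∀ Q ∈ K', ∀ y, SignType.sign ((sp x Q).eval y) = SignType.sign ((sp x' Q).eval (h y)) :=
    fun Q hQ => hh Q (Or.inl hQ)
  have hdm : derivative P ∈ K' := hK' ▸ Set.mem_insert _ _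
  have hKK : ∀ Q ∈ K, Q ∈ K' := fun Q hQ => hK' ▸ Set.mem_insert_of_mem _ hQ
  have hsd : ∀ x : Fin n → ℝ, sp x (derivative P) = derivative (sp x P) := fun x => by
    simp [sp, derivative_map]
  have hz : ∀ Q ∈ K', sp x Q = 0 ↔ sp x' Q = 0 := by
    intro Q hQ
    rw [Polynomial.ext_iff, Polynomial.ext_iff]
    apply forall_congr'
    intro i
    simp only [sp, coeff_map, coeff_zero]
    rw [← sign_eq_zero_iff, hco Q hQ i, sign_eq_zero_iff]
  by_cases hd0 : sp x (derivative P) = 0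
  · have hd0' := (hz _ hdm).1 hd0
    rw [hsd] at hd0 hd0'
    refine ⟨h, ?_⟩
    rintro Q (rfl | hQ)
    · intro y
      rw [eq_C_of_natDegree_eq_zero (derivative_eq_zero.1 hd0),
        eq_C_of_natDegree_eq_zero (derivative_eq_zero.1 hd0')]
      simpa [sp] using hP0
    · exact hhK Q (hKK Q hQ)
  have hd0' := mt (hz _ hdm).2 hd0
  let Z : Set ℝ := ⋃ Q ∈ K', {z | sp x Q ≠ 0 ∧ (sp x Q).eval z = 0}
  have hZf : Z.Finite := by
    refine hK'f.biUnion fun Q _ => ?_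
    by_cases h0 : sp x Q = 0
    · simp [h0]
    · refine (Polynomial.finite_setOfPred_isRoot h0).subset fun z hz => hz.2
  have hZm : ∀ Q ∈ K', sp x Q ≠ 0 → ∀ z, (sp x Q).eval z = 0 → z ∈ Z := by
    intro Q hQ h0 z hz
    exact Set.mem_biUnion hQ ⟨h0, hz⟩
  have hZs : ∀ z ∈ Z, SignType.sign ((sp x P).eval z) = SignType.sign ((sp x' P).eval (h z)) := by
    intro z hzZ
    simp only [Z, Set.mem_iUnion, Set.mem_ofPred_eq] at hzZ
    obtain ⟨Q, hQ, h0, hz0⟩ := hzZ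
    set j := (sp x Q).natDegree with hj
    have hlc : MvPolynomial.eval x (Q.coeff j) ≠ 0 := by
      have := leadingCoeff_ne_zero.2 h0
      rwa [leadingCoeff, sp, coeff_map] at this
    have hjD : j ≤ D := by
      by_contra hc
      apply hlc
      rw [hD Q hQ j (by omega), map_zero]
    have hv : ∀ i > j, MvPolynomial.eval x (Q.coeff i) = 0 := by
      intro i hi
      have := coeff_eq_zero_of_natDegree_lt (p := sp x Q) (n := i) hi
      rwa [sp, coeff_map] at this
    have hv' : ∀ i > j, MvPolynomial.eval x' (Q.coeff i) = 0 := by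
      intro i hi
      rw [← sign_eq_zero_iff, ← hco Q hQ i, sign_eq_zero_iff, hv i hi]
    have hz0' : (sp x' Q).eval (h z) = 0 := by
      rw [← sign_eq_zero_iff, ← hhK Q hQ z, sign_eq_zero_iff, hz0]
    obtain ⟨e, A, he⟩ := rm_spec P Q j
    have e1 := congrArg SignType.sign (rm_eval x P Q j e A he hv z hz0)
    have e2 := congrArg SignType.sign (rm_eval x' P Q j e A he hv' (h z) hz0')
    rw [hh (rm P Q j) (Or.inr ⟨(Q, j), ⟨hQ, hjD⟩, rfl⟩) z, ← e2, sign_mul, sign_mul, sign_pow,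
      sign_pow, hco Q hQ j] at e1
    refine mul_left_cancel₀ (pow_ne_zero e ?_) e1
    rw [← hco Q hQ j]
    simpa using hlc
  have hS := poly_setup (sp x P) (sp x' P) h Z hZf (hsd x ▸ hd0) (hsd x' ▸ hd0')
    (by rw [← hsd, ← hsd]; exact hhK _ hdm)
    (by rw [← hsd]; exact hZm _ hdm hd0) hZs
  have hp0 : sp x P ≠ 0 := by
    intro h0; apply hd0; rw [hsd, h0, derivative_zero]
  obtain ⟨k, k1, k2⟩ := hS.main (Polynomial.finite_setOfPred_isRoot hp0)
  refine ⟨k.trans h, ?_⟩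
  rintro Q (rfl | hQ)
  · exact k2
  · intro y
    have hQ' := hKK Q hQ
    change _ = SignType.sign ((sp x' Q).eval (h (k y)))
    rw [← hhK Q hQ']
    by_cases h0 : sp x Q = 0
    · simp [h0]
    · exact sign_const_cut (sp x Q).continuous (hZm Q hQ' h0) (k1 y).symm

lemma good_all (d : ℕ) : ∀ L : Set (MvPolynomial (Fin n) ℝ)[X], L.Finite →
    (∀ Q ∈ L, ∀ i ≥ d, Q.coeff i = 0) → Good L := by
  induction d with
  | zero =>
    intro L hL h
    refine ⟨∅, Set.finite_empty, fun x x' _ => ⟨OrderIso.refl ℝ, fun P hP y => ?_⟩⟩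
    have : P = 0 := by ext1 i; exact h P hP i (by omega)
    simp [this, sp]
  | succ d ih =>
    have key : ∀ M : Set (MvPolynomial (Fin n) ℝ)[X], M.Finite →
        (∀ Q ∈ M, ∀ i ≥ d + 1, Q.coeff i = 0) →
        ∀ L : Set (MvPolynomial (Fin n) ℝ)[X], L.Finite →
        (∀ Q ∈ L, ∀ i ≥ d, Q.coeff i = 0) → Good (M ∪ L) := by
      intro M hM
      induction M, hM using Set.Finite.induction_on with
      | empty => intro _ L hL h; simpa using ih L hL h
      | @insert P M hP hMf ihM =>
        intro hMd L hL hLd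
        rw [Set.insert_union]
        have hder : ∀ i ≥ d, (derivative P).coeff i = 0 := by
          intro i hi
          rw [coeff_derivative, hMd P (Set.mem_insert _ _) (i + 1) (by omega), zero_mul]
        refine step P (M ∪ L) (insert (derivative P) (M ∪ L)) (hMf.union hL) rfl d ?_ ?_
        · rintro Q (rfl | hQ | hQ) i hi
          · exact hder i (by omega)
          · exact hMd Q (Set.mem_insert_of_mem _ hQ) i (by omega)
          · exact hLd Q hQ i (by omega)
        · have := ihM (fun Q hQ => hMd Q (Set.mem_insert_of_mem _ hQ))
            (insert (derivative P) L ∪ (fun a : (MvPolynomial (Fin n) ℝ)[X] × ℕ => rm P a.1 a.2) ''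
              ((insert (derivative P) (M ∪ L)) ×ˢ Set.Iic d))
            ((hL.insert _).union ((((hMf.union hL).insert _).prod (Set.finite_Iic d)).image _))
            (by
              rintro Q ((rfl | hQ) | ⟨⟨Q', j⟩, ⟨-, hj⟩, rfl⟩) i hi
              · exact hder i hi
              · exact hLd Q hQ i hi
              · exact rm_deg P Q' j i (le_trans hj hi))
          rwa [← Set.union_assoc, Set.union_insert] at this
    intro L hL h
    simpa using key L hL h ∅ Set.finite_empty (by simp)

noncomputable def toP (n : ℕ) : MvPolynomial (Fin (n + 1)) ℝ →ₐ[ℝ] (MvPolynomial (Fin n) ℝ)[X] :=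
  MvPolynomial.aeval (Fin.snoc (α := fun _ => (MvPolynomial (Fin n) ℝ)[X])
    (fun i => C (MvPolynomial.X i)) X)

lemma toP_eval (x : Fin n → ℝ) (y : ℝ) (p : MvPolynomial (Fin (n + 1)) ℝ) :
    (sp x (toP n p)).eval y = MvPolynomial.eval (Fin.snoc (α := fun _ => ℝ) x y) p := by
  induction p using MvPolynomial.induction_on with
  | C a =>
    simp [toP, sp, MvPolynomial.algebraMap_eq, Polynomial.algebraMap_apply]
  | add p q hp hq =>
    simp only [sp, map_add, Polynomial.map_add, eval_add] at hp hq ⊢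
    rw [hp, hq]
  | mul_X p i hp =>
    simp only [sp, map_mul, Polynomial.map_mul, eval_mul] at hp ⊢
    rw [hp]
    congr 1
    refine Fin.lastCases ?_ (fun i => ?_) i <;> simp [toP]

end TS2

lemma union_of_signs {n : ℕ} (A : Set (Fin n → ℝ)) (F : Set (MvPolynomial (Fin n) ℝ))
    (hF : F.Finite) (hA : ∀ x x', SameSign F x x' → x ∈ A → x' ∈ A) :
    IsUnionOfBasicSemialgebraic n A := by
  classical
  obtain ⟨m, c, hc⟩ : ∃ (m : ℕ) (c : Fin m → MvPolynomial (Fin n) ℝ), Set.range c = F := by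
    have := hF.fintype
    exact ⟨Fintype.card F, fun i => ((Fintype.equivFin F).symm i : MvPolynomial (Fin n) ℝ), by
      rw [show (fun i => ((Fintype.equivFin F).symm i : MvPolynomial (Fin n) ℝ)) =
        Subtype.val ∘ (Fintype.equivFin F).symm from rfl, EquivLike.range_comp, Subtype.range_coe]⟩
  let sg : (Fin n → ℝ) → Fin m → SignType := fun x i => SignType.sign (MvPolynomial.eval x (c i))
  let I := {σ : Fin m → SignType // ∃ x ∈ A, sg x = σ}
  let e := Fintype.equivFin I
  refine ⟨Fintype.card I, fun j => {x | sg x = (e.symm j).1}, fun j => ?_, ?_⟩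
  · change IsBasicSemialgebraic n {x | sg x = (e.symm j).1}
    generalize (e.symm j).1 = σ
    refine ⟨m, fun i => if σ i = -1 then - c i else c i, fun i => decide (σ i ≠ 0), ?_⟩
    ext x
    simp only [sg, Set.mem_ofPred_eq, funext_iff]
    apply forall_congr'
    intro i
    rcases h : σ i with _ | _ | _
    · change SignType.sign _ = 0 ↔ _
      rw [sign_eq_zero_iff]
      simp
    · change SignType.sign _ = -1 ↔ _
      rw [sign_eq_neg_one_iff]
      simp
    · change SignType.sign _ = 1 ↔ _
      rw [sign_eq_one_iff]
      simp
  · ext x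
    simp only [Set.mem_iUnion, Set.mem_ofPred_eq]
    constructor
    · intro hx
      exact ⟨e ⟨sg x, x, hx, rfl⟩, by simp⟩
    · rintro ⟨j, hj⟩
      obtain ⟨y, hy, hyj⟩ := (e.symm j).2
      refine hA y x ?_ hy
      intro d hd
      rw [← hc] at hd
      obtain ⟨i, rfl⟩ := hd
      exact congrFun (hyj.trans hj.symm) i

/-- **Tarski–Seidenberg theorem** (projection form): if `S ⊆ ℝ^{n+1}` is a finite union of
solution sets of finite systems of polynomial conditions `p = 0` or `p > 0`, then its image
under the projection `ℝ^{n+1} → ℝ^n` forgetting the last coordinate is again such a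
finite union. -/
theorem tarski_seidenberg (n : ℕ) (S : Set (Fin (n + 1) → ℝ))
    (hS : IsUnionOfBasicSemialgebraic (n + 1) S) :
    IsUnionOfBasicSemialgebraic n
      ((fun x : Fin (n + 1) → ℝ => fun i : Fin n => x i.castSucc) '' S) := by
  obtain ⟨m, T, hT, rfl⟩ := hS
  choose k p s hps using hT
  let L : Set (Polynomial (MvPolynomial (Fin n) ℝ)) :=
    Set.range fun a : (j : Fin m) × Fin (k j) => toP n (p a.1 a.2)
  have hL : L.Finite := Set.finite_range _
  obtain ⟨d, hd⟩ : ∃ d : ℕ, ∀ Q ∈ L, ∀ i ≥ d, Q.coeff i = 0 := by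
    obtain ⟨d, hd⟩ := (hL.image Polynomial.natDegree).bddAbove
    refine ⟨d + 1, fun Q hQ i hi => Polynomial.coeff_eq_zero_of_natDegree_lt ?_⟩
    have := hd (Set.mem_image_of_mem _ hQ)
    omega
  obtain ⟨F, hF, hE⟩ := good_all d L hL hd
  refine union_of_signs _ F hF ?_
  rintro x x' hxx ⟨w, hw, rfl⟩
  obtain ⟨h, hh⟩ := hE _ x' hxx
  obtain ⟨j, hj⟩ := Set.mem_iUnion.1 hw
  refine ⟨Fin.snoc (α := fun _ => ℝ) x' (h (w (Fin.last n))), Set.mem_iUnion.2 ⟨j, ?_⟩, ?_⟩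
  · rw [hps j] at hj ⊢
    intro i
    have h1 := hj i
    have h2 := hh (toP n (p j i)) ⟨⟨j, i⟩, rfl⟩ (w (Fin.last n))
    rw [toP_eval, toP_eval] at h2
    have h3 : (Fin.snoc (α := fun _ => ℝ) (fun i : Fin n => w i.castSucc) (w (Fin.last n))) = w :=
      Fin.snoc_init_self w
    rw [h3] at h2
    split_ifs at h1 ⊢ with hs
    · rw [sign_pos h1] at h2
      exact sign_eq_one_iff.1 h2.symm
    · rw [h1, sign_zero] at h2
      exact sign_eq_zero_iff.1 h2.symm
  · ext i
    simp
end

section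
/- Let f_1, …, f_k ∈ ℝ[X] be nonconstant, squarefree, and pairwise relatively prime univariate polynomials, let P = f_1 ⋯ f_k, and let R > 0 be such that every real root of P lies in the open interval (−R, R). Define f = P' · (X − R) · (X + R), where P' is the derivative of P. Then for every sign vector σ ∈ {−1, +1}^k: if there exists x ∈ ℝ such that the sign of f_i(x) equals σ_i for every i, then there exists z ∈ ℝ with f(z) = 0 and the sign of f_i(z) equal to σ_i for every i (in particular f_i(z) ≠ 0 for all i). -/
open Polynomial

/-- Input preparation for the Ben-Or–Kozen–Reif algorithm: let `f₁, …, f_k` be nonconstant,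
squarefree, pairwise relatively prime, `P = f₁ ⋯ f_k`, and `R > 0` such that all real roots
of `P` lie in `(−R, R)`. Put `f = P' (X − R)(X + R)`. Then every strict consistent sign
assignment for `f₁, …, f_k` (a sign vector `σ ∈ {−1, +1}^k`, encoded by `σ : Fin k → Bool`
with `true ↦ +1`, `false ↦ −1`) is witnessed at a real root of `f`. -/
theorem BKR_input_preparation (k : ℕ) (F : Fin k → Polynomial ℝ)
    (hdeg : ∀ i, 0 < (F i).natDegree) (hsf : ∀ i, Squarefree (F i))
    (hcop : ∀ i j, i ≠ j → IsCoprime (F i) (F j))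
    (P : Polynomial ℝ) (hP : P = ∏ i, F i)
    (R : ℝ) (hR : 0 < R) (hroots : ∀ x : ℝ, P.eval x = 0 → x ∈ Set.Ioo (-R) R)
    (f : Polynomial ℝ) (hf : f = P.derivative * (X - C R) * (X + C R))
    (σ : Fin k → Bool)
    (hex : ∃ x : ℝ, ∀ i, if σ i then 0 < (F i).eval x else (F i).eval x < 0) :
    ∃ z : ℝ, f.eval z = 0 ∧
      ∀ i, if σ i then 0 < (F i).eval z else (F i).eval z < 0 := by
  obtain ⟨x, hx⟩ := hex
  have hFx : ∀ i, (F i).eval x ≠ 0 := by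
    intro i
    have h := hx i
    split_ifs at h
    · exact h.ne'
    · exact h.ne
  have hPx : P.eval x ≠ 0 := by
    rw [hP, eval_prod]
    exact Finset.prod_ne_zero_iff.mpr fun i _ => hFx i
  have hP0 : P ≠ 0 := by
    rintro h
    simp [h] at hPx
  have key : ∀ z : ℝ, (∀ y ∈ Set.uIcc x z, P.eval y ≠ 0) →
      ∀ i, if σ i then 0 < (F i).eval z else (F i).eval z < 0 := by
    intro z hz i
    have hne : ∀ y ∈ Set.uIcc x z, (F i).eval y ≠ 0 := by
      intro y hy h
      apply hz y hy
      rw [hP, eval_prod]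
      exact Finset.prod_eq_zero (Finset.mem_univ i) h
    have hiv := intermediate_value_uIcc (a := x) (b := z) (f := fun y => (F i).eval y)
      (F i).continuous.continuousOn
    have h0 : (0 : ℝ) ∉ Set.uIcc ((F i).eval x) ((F i).eval z) := by
      intro h
      obtain ⟨y, hy, hy0⟩ := hiv h
      exact hne y hy hy0
    have h := hx i
    rw [Set.mem_uIcc] at h0
    push Not at h0
    split_ifs at h ⊢
    · by_contra hc
      exact absurd (h0.2 (not_lt.mp hc)) (not_lt.mpr h.le)
    · by_contra hc
      exact absurd (h0.1 h.le) hc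
  by_cases hB : ∃ b, x ≤ b ∧ P.eval b = 0
  swap
  · push Not at hB
    refine ⟨R, by simp [hf], key R ?_⟩
    intro y hy h
    rcases Set.mem_uIcc.mp hy with h1 | h1
    · exact hB y h1.1 h
    · exact absurd (hroots y h).2 (not_lt.mpr h1.1)
  by_cases hA : ∃ a, a ≤ x ∧ P.eval a = 0
  swap
  · push Not at hA
    refine ⟨-R, by simp [hf], key (-R) ?_⟩
    intro y hy h
    rcases Set.mem_uIcc.mp hy with h1 | h1
    · exact absurd (hroots y h).1 (not_lt.mpr h1.2)
    · exact hA y h1.2 h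
  have hmem : ∀ y, y ∈ P.roots.toFinset ↔ P.eval y = 0 := by
    intro y
    simp [hP0]
  obtain ⟨b, hb, hbmin⟩ := Finset.exists_min_image (P.roots.toFinset.filter (x ≤ ·)) id (by
    obtain ⟨b, h1, h2⟩ := hB
    exact ⟨b, Finset.mem_filter.mpr ⟨(hmem b).2 h2, h1⟩⟩)
  obtain ⟨a, ha, hamax⟩ := Finset.exists_max_image (P.roots.toFinset.filter (· ≤ x)) id (by
    obtain ⟨b, h1, h2⟩ := hA
    exact ⟨b, Finset.mem_filter.mpr ⟨(hmem b).2 h2, h1⟩⟩)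
  rw [Finset.mem_filter, hmem] at ha hb
  simp only [Finset.mem_filter, hmem, id] at hbmin hamax
  have hax : a < x := lt_of_le_of_ne ha.2 (fun h => hPx (h ▸ ha.1))
  have hxb : x < b := lt_of_le_of_ne hb.2 (fun h => hPx (h ▸ hb.1))
  obtain ⟨z, hz, hdz⟩ := exists_hasDerivAt_eq_zero (f := fun y => P.eval y)
    (f' := fun y => P.derivative.eval y) (hax.trans hxb) P.continuous.continuousOn
    (by simp [ha.1, hb.1]) (fun y _ => P.hasDerivAt y)
  refine ⟨z, by simp [hf, hdz], key z ?_⟩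
  intro y hy h
  have hay : a < y ∧ y < b := by
    rcases Set.mem_uIcc.mp hy with h1 | h1
    · exact ⟨hax.trans_le h1.1, h1.2.trans_lt hz.2⟩
    · exact ⟨hz.1.trans_le h1.1, h1.2.trans_lt hxb⟩
  rcases le_total x y with h1 | h1
  · exact absurd (hbmin y ⟨h, h1⟩) (not_le.mpr hay.2)
  · exact absurd (hamax y ⟨h, h1⟩) (not_le.mpr hay.1)
end

section
/- Let f_1, …, f_k ∈ ℝ[X_1, …, X_n] with deg(f_i) < d for all i, let D be the minimal even integer with D ≥ kd + 1, and for ε > 0 define g_ε = ∏_{i=1}^k (f_i + ε) − ε^{k+1} Σ_{j=1}^n X_j^D. Assume the solution set {x ∈ ℝ^n : f_i(x) ≥ 0 for all i} is nonempty and bounded. Then there exists ε_0 > 0 such that for every ε with 0 < ε < ε_0 there is a point v ∈ ℝ^n with ∂g_ε/∂X_j(v) = 0 for all j ∈ {1, …, n} and f_i(v) + ε > 0 for all i ∈ {1, …, k}. Moreover, if ε_m → 0⁺ and v_m are such points with v_m → v', then f_i(v') ≥ 0 for all i, i.e. the limit point v' is a solution of the original system. -/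
open MvPolynomial Filter


theorem aux_bound {n : ℕ} (p : MvPolynomial (Fin n) ℝ) (m : ℕ) (hp : p.totalDegree ≤ m) :
    ∃ B : ℝ, 0 ≤ B ∧ ∀ x : Fin n → ℝ, 1 ≤ ‖x‖ → eval x p ≤ B * ‖x‖ ^ m := by
  refine ⟨∑ e ∈ p.support, |coeff e p|, Finset.sum_nonneg fun _ _ => abs_nonneg _, ?_⟩
  intro x hx
  rw [eval_eq', Finset.sum_mul]
  refine Finset.sum_le_sum fun e he => ?_
  refine (le_abs_self _).trans ?_
  rw [abs_mul]
  refine mul_le_mul_of_nonneg_left ?_ (abs_nonneg _)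
  rw [Finset.abs_prod]
  have h1 : ∏ i, |x i ^ e i| ≤ ∏ i, ‖x‖ ^ e i := by
    refine Finset.prod_le_prod (fun _ _ => abs_nonneg _) fun i _ => ?_
    rw [abs_pow]
    exact pow_le_pow_left₀ (abs_nonneg _) (norm_le_pi_norm x i) _
  refine h1.trans ?_
  rw [Finset.prod_pow_eq_pow_sum]
  refine pow_le_pow_right₀ hx ?_
  have h2 := le_totalDegree he
  rw [Finsupp.sum_fintype _ _ (fun _ => rfl)] at h2
  exact h2.trans hp

theorem aux_deriv {n : ℕ} (p : MvPolynomial (Fin n) ℝ) (v : Fin n → ℝ) (j : Fin n) :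
    HasDerivAt (fun t : ℝ => eval (Function.update v j t) p) (eval v (pderiv j p)) (v j) := by
  induction p using MvPolynomial.induction_on with
  | C a => simpa using hasDerivAt_const (v j) a
  | add p q hp hq => simpa using hp.fun_add hq
  | mul_X p i hp =>
    have hX : HasDerivAt (fun t : ℝ => Function.update v j t i)
        (eval v (pderiv j (X i : MvPolynomial (Fin n) ℝ))) (v j) := by
      by_cases h : i = j
      · subst h
        simpa using hasDerivAt_id' (v i)
      · simpa [Function.update_of_ne h, pderiv_X_of_ne h] using hasDerivAt_const (v j) (v i)
    have := hp.fun_mul hX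
    simp only [Function.update_eq_self] at this
    simp only [Derivation.leibniz, map_add, map_mul, smul_eq_mul, eval_X]
    refine this.congr_deriv ?_
    ring

theorem aux_norm {n D : ℕ} (hD : Even D) (x : Fin n → ℝ) (hx : 1 ≤ ‖x‖) :
    ‖x‖ ^ D ≤ ∑ j, x j ^ D := by
  have hn : Nonempty (Fin n) := by
    by_contra h
    rw [not_nonempty_iff] at h
    have : x = 0 := Subsingleton.elim _ _
    rw [this, norm_zero] at hx
    linarith
  obtain ⟨j, hj⟩ : ∃ j, ‖x‖ ≤ |x j| := by
    by_contra! h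
    have := (pi_norm_lt_iff (x := x) (r := ‖x‖) (by linarith)).2 h
    exact lt_irrefl _ this
  calc ‖x‖ ^ D ≤ |x j| ^ D := pow_le_pow_left₀ (norm_nonneg _) hj _
    _ = x j ^ D := hD.pow_abs _
    _ ≤ _ := Finset.single_le_sum (f := fun j => x j ^ D)
      (fun i _ => hD.pow_nonneg _) (Finset.mem_univ j)

/-- Reduction of consistency of a bounded system of nonstrict polynomial inequalities to the
critical-point equations of `g_ε = ∏_{i=1}^k (f_i + ε) − ε^{k+1} Σ_{j=1}^n X_j^D`, where `D` is
the minimal even integer with `D ≥ kd + 1`: for all sufficiently small `ε > 0` there is a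
critical point `v` of `g_ε` with `f_i(v) + ε > 0` for all `i`, and any limit `v'` of such
points as `ε → 0⁺` is a solution of the system `f₁ ≥ 0, …, f_k ≥ 0`. -/
theorem consistency_via_critical_points (n k d D : ℕ)
    (f : Fin k → MvPolynomial (Fin n) ℝ) (hdeg : ∀ i, (f i).totalDegree < d)
    (hDeven : Even D) (hDge : k * d + 1 ≤ D)
    (hDmin : ∀ D' : ℕ, Even D' → k * d + 1 ≤ D' → D ≤ D')
    (g : ℝ → MvPolynomial (Fin n) ℝ)
    (hg : ∀ ε : ℝ, g ε = (∏ i, (f i + C ε)) - C ε ^ (k + 1) * ∑ j, X j ^ D)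
    (hne : {x : Fin n → ℝ | ∀ i, 0 ≤ eval x (f i)}.Nonempty)
    (hbdd : Bornology.IsBounded {x : Fin n → ℝ | ∀ i, 0 ≤ eval x (f i)}) :
    ∃ ε₀ : ℝ, 0 < ε₀ ∧
      (∀ ε : ℝ, 0 < ε → ε < ε₀ → ∃ v : Fin n → ℝ,
        (∀ j : Fin n, eval v (pderiv j (g ε)) = 0) ∧ ∀ i, 0 < eval v (f i) + ε) ∧
      (∀ (εm : ℕ → ℝ) (vm : ℕ → Fin n → ℝ) (v' : Fin n → ℝ),
        (∀ m, 0 < εm m) → Tendsto εm atTop (nhds 0) →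
        (∀ m, (∀ j : Fin n, eval (vm m) (pderiv j (g (εm m))) = 0) ∧
          ∀ i, 0 < eval (vm m) (f i) + εm m) →
        Tendsto vm atTop (nhds v') →
        ∀ i, 0 ≤ eval v' (f i)) := by
  obtain ⟨x0, hx0⟩ := hne
  have hcont : ∀ p : MvPolynomial (Fin n) ℝ, Continuous fun x : Fin n → ℝ => eval x p :=
    fun p => MvPolynomial.continuous_eval p
  set S := ∑ j, x0 j ^ D with hS
  have hS0 : 0 ≤ S := Finset.sum_nonneg fun j _ => hDeven.pow_nonneg _
  refine ⟨1 / (S + 1), by positivity, ?_, ?_⟩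
  · intro ε hε hε0
    have hSε : ε * S < 1 := by
      rw [lt_div_iff₀ (by positivity)] at hε0
      nlinarith
    have hev : ∀ x : Fin n → ℝ, eval x (g ε) =
        (∏ i, (eval x (f i) + ε)) - ε ^ (k + 1) * ∑ j, x j ^ D := by
      intro x
      simp [hg, eval_prod]
    have hpos : 0 < eval x0 (g ε) := by
      rw [hev, ← hS]
      have h1 : ε ^ k ≤ ∏ i, (eval x0 (f i) + ε) := by
        calc ε ^ k = ∏ i : Fin k, ε := by simp
          _ ≤ _ := Finset.prod_le_prod (fun _ _ => hε.le) fun i _ => by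
            have := hx0 i
            linarith
      have h2 : 0 < ε ^ k := by positivity
      rw [pow_succ]
      nlinarith
    have htd : (∏ i, (f i + C ε)).totalDegree ≤ k * d := by
      refine (totalDegree_finset_prod _ _).trans ?_
      calc _ ≤ ∑ i : Fin k, d := Finset.sum_le_sum fun i _ => by
            refine (totalDegree_add _ _).trans ?_
            rw [totalDegree_C]
            exact max_le (hdeg i).le (Nat.zero_le _)
        _ = k * d := by simp
    obtain ⟨B, hB0, hB⟩ := aux_bound _ _ htd
    set R := max (max 1 (B / ε ^ (k + 1))) ‖x0‖ with hR
    have hout : ∀ x : Fin n → ℝ, R < ‖x‖ → eval x (g ε) < 0 := by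
      intro x hx
      have h1 : 1 < ‖x‖ := lt_of_le_of_lt ((le_max_left _ _).trans (le_max_left _ _)) hx
      have h2 : B / ε ^ (k + 1) < ‖x‖ :=
        lt_of_le_of_lt ((le_max_right _ _).trans (le_max_left _ _)) hx
      rw [div_lt_iff₀ (by positivity)] at h2
      have h3 := hB x h1.le
      have h4 := aux_norm hDeven x h1.le
      have h5 : ‖x‖ ^ (k * d + 1) ≤ ‖x‖ ^ D := pow_le_pow_right₀ h1.le hDge
      have h6 : eval x (∏ i, (f i + C ε)) = ∏ i, (eval x (f i) + ε) := by simp [eval_prod]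
      rw [h6] at h3
      rw [hev]
      have h7 : 0 < ε ^ (k + 1) := by positivity
      have h8 : 0 < ‖x‖ ^ (k * d) := by positivity
      have h9 := mul_le_mul_of_nonneg_left (h5.trans h4) h7.le
      have h10 := mul_lt_mul_of_pos_right h2 h8
      rw [pow_succ ‖x‖] at h9
      nlinarith
    set W : Set (Fin n → ℝ) := {x | ∀ i, 0 ≤ eval x (f i) + ε} with hW
    have hWc : IsClosed W := by
      rw [hW, Set.setOf_forall]
      exact isClosed_iInter fun i => isClosed_le continuous_const ((hcont _).add continuous_const)
    have hK : IsCompact (Metric.closedBall (0 : Fin n → ℝ) R ∩ W) :=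
      (isCompact_closedBall _ _).inter_right hWc
    have hx0K : x0 ∈ Metric.closedBall (0 : Fin n → ℝ) R ∩ W := by
      refine ⟨by simp [hR], fun i => ?_⟩
      have := hx0 i
      linarith
    obtain ⟨v, hvK, hv⟩ := hK.exists_isMaxOn ⟨x0, hx0K⟩ (hcont (g ε)).continuousOn
    have hvpos : 0 < eval v (g ε) := hpos.trans_le (hv hx0K)
    have hvi : ∀ i, 0 < eval v (f i) + ε := by
      intro i
      refine lt_of_le_of_ne (hvK.2 i) fun h => ?_
      rw [hev, Finset.prod_eq_zero (Finset.mem_univ i) h.symm] at hvpos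
      have h1 : 0 ≤ ∑ j, v j ^ D := Finset.sum_nonneg fun j _ => hDeven.pow_nonneg _
      have h7 : 0 < ε ^ (k + 1) := by positivity
      nlinarith
    refine ⟨v, fun j => ?_, hvi⟩
    have hloc : IsLocalMax (fun x : Fin n → ℝ => eval x (g ε)) v := by
      have hmem : ∀ᶠ x in nhds v, ∀ i, 0 < eval x (f i) + ε := by
        rw [eventually_all]
        intro i
        exact ((hcont (f i)).add continuous_const).continuousAt.eventually
          (lt_mem_nhds (hvi i))
      filter_upwards [hmem] with x hx
      by_cases hxR : ‖x‖ ≤ R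
      · exact hv ⟨by simpa using hxR, fun i => (hx i).le⟩
      · exact ((hout x (not_le.1 hxR)).trans hvpos).le
    have hloc2 : IsLocalMax (fun t : ℝ => eval (Function.update v j t) (g ε)) (v j) := by
      have hc : Tendsto (fun t : ℝ => Function.update v j t) (nhds (v j)) (nhds v) := by
        have : Continuous fun t : ℝ => Function.update v j t :=
          continuous_const.update j continuous_id
        simpa using this.tendsto (v j)
      have := hc.eventually hloc
      simpa [IsLocalMax, IsMaxFilter] using this
    exact hloc2.hasDerivAt_eq_zero (aux_deriv _ _ _)
  · intro εm vm v' _ hε0 h hv i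
    have h1 : Tendsto (fun m => eval (vm m) (f i) + εm m) atTop (nhds (eval v' (f i) + 0)) :=
      (((hcont (f i)).tendsto v').comp hv).add hε0
    rw [add_zero] at h1
    exact ge_of_tendsto' h1 fun m => ((h m).2 i).le
end

section
/- Let n ≥ 1, r ≥ 1, and let η^{(1)}, …, η^{(r)} ∈ ℝ^{n+1} be nonzero vectors. Then there exists an integer i with 1 ≤ i ≤ nr + 1 such that the vector α = (1, i, i², …, i^n) satisfies ⟨α, η^{(l)}⟩ ≠ 0 for every l ∈ {1, …, r}. -/
/-- Among the Vandermonde points `α = (1, i, i², …, i^n)` for `1 ≤ i ≤ nr + 1`, at least one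
avoids all `r` hyperplanes through the origin with given nonzero normal vectors
`η^{(1)}, …, η^{(r)} ∈ ℝ^{n+1}`. -/
theorem generic_vandermonde_direction (n r : ℕ) (hn : 1 ≤ n) (hr : 1 ≤ r)
    (η : Fin r → Fin (n + 1) → ℝ) (hη : ∀ l, η l ≠ 0) :
    ∃ i : ℕ, 1 ≤ i ∧ i ≤ n * r + 1 ∧
      ∀ l : Fin r, ∑ j : Fin (n + 1), (i : ℝ) ^ (j : ℕ) * η l j ≠ 0 := by
  by_contra! hcon
  let P : Fin r → Polynomial ℝ := fun l =>
    ∑ j : Fin (n + 1), Polynomial.C (η l j) * Polynomial.X ^ (j : ℕ)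
  have hP0 : ∀ l, P l ≠ 0 := by
    intro l h
    apply hη l
    funext k
    have h1 : (P l).coeff (k : ℕ) = 0 := by rw [h]; simp
    simpa [P, Polynomial.finsetSum_coeff, Polynomial.coeff_C_mul, Polynomial.coeff_X_pow,
      Fin.val_inj] using h1
  have hPd : ∀ l, (P l).natDegree ≤ n := by
    intro l
    apply Polynomial.natDegree_sum_le_of_forall_le
    intro j _
    exact (Polynomial.natDegree_C_mul_X_pow_le _ _).trans (by omega)
  have hPe : ∀ l (x : ℝ), (P l).eval x = ∑ j : Fin (n + 1), x ^ (j : ℕ) * η l j := by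
    intro l x
    simp only [P, Polynomial.eval_finsetSum, Polynomial.eval_mul, Polynomial.eval_C,
      Polynomial.eval_pow, Polynomial.eval_X]
    exact Finset.sum_congr rfl fun j _ => mul_comm _ _
  have hQ0 : (∏ l, P l) ≠ 0 := Finset.prod_ne_zero_iff.mpr fun l _ => hP0 l
  have hQd : (∏ l, P l).natDegree ≤ n * r := by
    refine (Polynomial.natDegree_prod_le _ _).trans ?_
    refine (Finset.sum_le_sum fun l _ => hPd l).trans ?_
    simp [mul_comm]
  apply hQ0
  refine Polynomial.eq_zero_of_natDegree_lt_card_of_eval_eq_zero _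
    (f := fun i : Fin (n * r + 1) => (((i : ℕ) + 1 : ℕ) : ℝ)) ?_ ?_ ?_
  · intro a b hab
    have h2 : (a : ℕ) + 1 = (b : ℕ) + 1 := Nat.cast_injective hab
    ext
    omega
  · intro i
    obtain ⟨l, hl⟩ := hcon ((i : ℕ) + 1) (by omega) (by omega)
    rw [Polynomial.eval_prod]
    exact Finset.prod_eq_zero (Finset.mem_univ l) ((hPe l _).trans hl)
  · simp only [Fintype.card_fin]
    omega
end

section
/- Let n ≥ 1, r ≥ 1, and let η^{(1)}, …, η^{(r)} ∈ ℝ^{n+1} be nonzero vectors. Let S_1 = {(1, i, i², …, i^n) : 1 ≤ i ≤ nr + 1} and S_2 = {(1, i, i², …, i^n) : 1 ≤ i ≤ nr(r−1)/2 + 1}. Then there exist α ∈ S_1 and β ∈ S_2 such that: (1) for every l ∈ {1, …, r}, ⟨α, η^{(l)}⟩ ≠ 0, so the line t ↦ αt + β intersects the hyperplane {u ∈ ℝ^{n+1} : ⟨u, η^{(l)}⟩ = 0} at exactly one parameter value t^{(l)} ∈ ℝ; and (2) for all l ≠ m, if t^{(l)} = t^{(m)} then the vectors η^{(l)} and η^{(m)}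 are linearly dependent (i.e. the two hyperplanes coincide). -/
open Polynomial in
lemma vander_aux {ι : Type*} (n N : ℕ) (s : Finset ι) (v : ι → Fin (n + 1) → ℝ)
    (hN : n * s.card ≤ N) :
    ∃ a : ℕ, 1 ≤ a ∧ a ≤ N + 1 ∧ ∀ i ∈ s, v i ≠ 0 →
      (∑ j : Fin (n + 1), (a : ℝ) ^ (j : ℕ) * v i j) ≠ 0 := by
  classical
  set q : ι → ℝ[X] := fun i => ∑ j : Fin (n + 1), C (v i j) * X ^ (j : ℕ) with hq
  have hev : ∀ i (x : ℝ), (q i).eval x = ∑ j : Fin (n + 1), x ^ (j : ℕ) * v i j := by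
    intro i x
    simp only [hq, eval_finsetSum, eval_mul, eval_C, eval_pow, eval_X]
    exact Finset.sum_congr rfl fun j _ => mul_comm _ _
  have hdeg : ∀ i, (q i).natDegree ≤ n := by
    intro i
    apply natDegree_sum_le_of_forall_le
    intro j _
    exact (natDegree_C_mul_X_pow_le _ _).trans (by omega)
  have hne : ∀ i, v i ≠ 0 → q i ≠ 0 := by
    intro i hi h0
    apply hi
    funext j
    have := congrArg (fun p => p.coeff (j : ℕ)) h0
    simpa [hq, finsetSum_coeff, coeff_X_pow, Fin.val_inj] using this
  by_contra! hcon
  set P : ℝ[X] := ∏ i ∈ s.filter (fun i => v i ≠ 0), q i with hP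
  have hP0 : P ≠ 0 := Finset.prod_ne_zero_iff.2 fun i hi => hne i (Finset.mem_filter.1 hi).2
  have hPd : P.natDegree ≤ N := by
    refine (natDegree_prod_le _ _).trans ?_
    refine (Finset.sum_le_card_nsmul _ _ n fun i _ => hdeg i).trans ?_
    rw [smul_eq_mul, mul_comm]
    exact (Nat.mul_le_mul_left n (Finset.card_filter_le _ _)).trans hN
  apply hP0
  refine eq_zero_of_natDegree_lt_card_of_eval_eq_zero P
    (f := fun k : Fin (N + 1) => (((k : ℕ) + 1 : ℕ) : ℝ)) ?_ ?_ ?_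
  · intro x y h
    have : (x : ℕ) + 1 = y + 1 := Nat.cast_injective (R := ℝ) h
    exact Fin.ext (by omega)
  · intro k
    obtain ⟨i, his, hi, h⟩ := hcon (k + 1) (by omega) (by omega)
    rw [hP, eval_prod]
    exact Finset.prod_eq_zero (Finset.mem_filter.2 ⟨his, hi⟩) (by rw [hev]; exact h)
  · simpa using Nat.lt_succ_of_le hPd

/-- Existence of a generic straight line with Vandermonde direction and offset: given nonzero
normal vectors `η^{(1)}, …, η^{(r)} ∈ ℝ^{n+1}`, there are `α = (1, a, a², …, a^n)` with
`1 ≤ a ≤ nr + 1` and `β = (1, b, b², …, b^n)` with `1 ≤ b ≤ nr(r−1)/2 + 1` such that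
(1) `⟨α, η^{(l)}⟩ ≠ 0` for every `l`, so the line `t ↦ αt + β` meets each hyperplane
`{⟨u, η^{(l)}⟩ = 0}` at exactly one parameter value, and (2) if two of these hyperplanes
are met at the same parameter value, then their normal vectors are linearly dependent. -/
theorem generic_line_exists (n r : ℕ) (hn : 1 ≤ n) (hr : 1 ≤ r)
    (η : Fin r → Fin (n + 1) → ℝ) (hη : ∀ l, η l ≠ 0) :
    ∃ a b : ℕ, 1 ≤ a ∧ a ≤ n * r + 1 ∧ 1 ≤ b ∧ b ≤ n * r * (r - 1) / 2 + 1 ∧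
      (∀ l : Fin r,
        (∑ j : Fin (n + 1), (a : ℝ) ^ (j : ℕ) * η l j) ≠ 0 ∧
        ∃! t : ℝ, ∑ j : Fin (n + 1),
          ((a : ℝ) ^ (j : ℕ) * t + (b : ℝ) ^ (j : ℕ)) * η l j = 0) ∧
      (∀ l m_1 : Fin r, l ≠ m_1 → ∀ t : ℝ,
        (∑ j : Fin (n + 1), ((a : ℝ) ^ (j : ℕ) * t + (b : ℝ) ^ (j : ℕ)) * η l j = 0) →
        (∑ j : Fin (n + 1), ((a : ℝ) ^ (j : ℕ) * t + (b : ℝ) ^ (j : ℕ)) * η m_1 j = 0) →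
        ∃ c : ℝ, η m_1 = c • η l) := by
  have key : ∀ (x y t : ℝ) (w : Fin (n + 1) → ℝ),
      ∑ j : Fin (n + 1), (x ^ (j : ℕ) * t + y ^ (j : ℕ)) * w j =
        (∑ j : Fin (n + 1), x ^ (j : ℕ) * w j) * t + ∑ j : Fin (n + 1), y ^ (j : ℕ) * w j := by
    intro x y t w
    rw [Finset.sum_mul, ← Finset.sum_add_distrib]
    exact Finset.sum_congr rfl fun j _ => by ring
  obtain ⟨a, ha1, ha2, ha⟩ := vander_aux n (n * r) Finset.univ η (by simp)
  have hA : ∀ l, (∑ j : Fin (n + 1), (a : ℝ) ^ (j : ℕ) * η l j) ≠ 0 :=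
    fun l => ha l (Finset.mem_univ _) (hη l)
  set A : Fin r → ℝ := fun l => ∑ j : Fin (n + 1), (a : ℝ) ^ (j : ℕ) * η l j with hAdef
  obtain ⟨b, hb1, hb2, hb⟩ := vander_aux n (n * r * (r - 1) / 2)
    ((Finset.univ : Finset (Fin r)).sigma (fun m => Finset.Iio m))
    (fun p => A p.1 • η p.2 - A p.2 • η p.1) (by
      rw [Finset.card_sigma]
      simp only [Fin.card_Iio]
      rw [Fin.sum_univ_eq_sum_range (fun i => i) r, Finset.sum_range_id, mul_assoc]
      exact Nat.mul_div_le_mul_div_assoc _ _ _)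
  refine ⟨a, b, ha1, ha2, hb1, hb2, ?_, ?_⟩
  · intro l
    refine ⟨hA l, -(∑ j : Fin (n + 1), (b : ℝ) ^ (j : ℕ) * η l j) / A l, ?_, ?_⟩
    · have := hA l
      simp only [key]
      change A l * _ + _ = 0
      change A l ≠ 0 at this
      field_simp
      ring
    · intro t ht
      have := hA l
      simp only [key] at ht
      change A l * t + _ = 0 at ht
      change A l ≠ 0 at this
      field_simp
      linarith
  · have main : ∀ l m : Fin r, l < m → ∀ t : ℝ,
        (∑ j : Fin (n + 1), ((a : ℝ) ^ (j : ℕ) * t + (b : ℝ) ^ (j : ℕ)) * η l j = 0) →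
        (∑ j : Fin (n + 1), ((a : ℝ) ^ (j : ℕ) * t + (b : ℝ) ^ (j : ℕ)) * η m j = 0) →
        A m • η l = A l • η m := by
      intro l m hlm t h1 h2
      rw [key] at h1 h2
      by_contra hne
      refine hb ⟨m, l⟩ (by simpa using hlm) (sub_ne_zero.2 hne) ?_
      have e : ∑ j : Fin (n + 1), (b : ℝ) ^ (j : ℕ) * (A m • η l - A l • η m) j =
          A m * (∑ j : Fin (n + 1), (b : ℝ) ^ (j : ℕ) * η l j) -
          A l * (∑ j : Fin (n + 1), (b : ℝ) ^ (j : ℕ) * η m j) := by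
        rw [Finset.mul_sum, Finset.mul_sum, ← Finset.sum_sub_distrib]
        refine Finset.sum_congr rfl fun j _ => ?_
        simp only [Pi.sub_apply, Pi.smul_apply, smul_eq_mul]
        ring
      refine e.trans ?_
      change A l * t + _ = 0 at h1
      change A m * t + _ = 0 at h2
      linear_combination A m * h1 - A l * h2
    intro l m hlm t h1 h2
    have h : A m • η l = A l • η m := by
      rcases lt_or_gt_of_ne hlm with h | h
      · exact main l m h t h1 h2
      · exact (main m l h t h2 h1).symm
    refine ⟨(A l)⁻¹ * A m, ?_⟩
    rw [mul_smul, h, inv_smul_smul₀ (hA l)]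
end

section
/- Let f_1, …, f_k ∈ ℝ[X_1, …, X_n]. Then there exists ε > 0 such that the number of distinct consistent sign assignments for f_1, …, f_k is at most the number of connected components of the open set S = {x ∈ ℝ^n : ∏_{i=1}^k (f_i(x) + ε)² (f_i(x) − ε)² > 0}. -/
open MvPolynomial

namespace SignAux
open Set Topology Filter

/-- Finitely many points represent all path components of `S`. -/
def FinComp {X : Type*} [TopologicalSpace X] (S : Set X) : Prop :=
  ∃ A : Set X, A.Finite ∧ ∀ x ∈ S, ∃ a ∈ A, JoinedIn S x a

lemma alg {R : Type*} [CommRing R] [IsDomain R] [CharZero R] (P : Polynomial R) (hP : P ≠ 0) :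
    ∃ (P1 A B H : Polynomial R) (c : R) (m : ℕ), P1 ≠ 0 ∧ c ≠ 0 ∧
      A * P1 + B * Polynomial.derivative P1 = Polynomial.C c ∧
      Polynomial.C c * P1 ^ m = P * H := by
  classical
  let K := FractionRing R
  have hinj : Function.Injective (algebraMap R K) := IsFractionRing.injective R K
  have hpinj := Polynomial.map_injective _ hinj
  haveI : CharZero K := charZero_of_injective_algebraMap hinj
  set p := P.map (algebraMap R K) with hp
  have hp0 : p ≠ 0 := by
    rw [hp]; exact (Polynomial.map_ne_zero_iff hinj).2 hP
  have clear : ∀ q : Polynomial K, ∃ (b : R) (Q : Polynomial R), b ≠ 0 ∧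
      Q.map (algebraMap R K) = Polynomial.C (algebraMap R K b) * q := by
    intro q
    obtain ⟨b, hb, h⟩ := IsLocalization.integerNormalization_spec (nonZeroDivisors R) q
    refine ⟨b, _, nonZeroDivisors.ne_zero hb, h.trans ?_⟩
    rw [← Polynomial.smul_eq_C_mul, algebraMap_smul]
  have hsq : Squarefree (UniqueFactorizationMonoid.radical p) :=
    UniqueFactorizationMonoid.squarefree_radical
  obtain ⟨m, h, hm⟩ := UniqueFactorizationMonoid.exists_dvd_radical_self_pow hp0
  set q := UniqueFactorizationMonoid.radical p with hq
  have hq0 : q ≠ 0 := UniqueFactorizationMonoid.radical_ne_zero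
  obtain ⟨u, v, huv⟩ := PerfectField.separable_iff_squarefree.2 hsq
  obtain ⟨b, P1, hb, hP1⟩ := clear q
  obtain ⟨s, A, hs, hA⟩ := clear u
  obtain ⟨t, B, ht, hB⟩ := clear v
  obtain ⟨w, H, hw, hH⟩ := clear h
  refine ⟨P1, Polynomial.C (t * w) * A, Polynomial.C (s * w) * B,
    Polynomial.C (s * t * b * b ^ m) * H, s * t * w * b, m, ?_, ?_, ?_, ?_⟩
  · rintro rfl
    simp [hb, hq0] at hP1
  · simp [*]
  · apply hpinj
    simp only [Polynomial.map_add, Polynomial.map_mul, Polynomial.map_C, hA, hB, hP1,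
      ← Polynomial.derivative_map, Polynomial.derivative_mul, Polynomial.derivative_C, map_mul]
    linear_combination (Polynomial.C ((algebraMap R K) s) * Polynomial.C ((algebraMap R K) t) *
      Polynomial.C ((algebraMap R K) w) * Polynomial.C ((algebraMap R K) b)) * huv
  · apply hpinj
    simp only [Polynomial.map_mul, Polynomial.map_pow, Polynomial.map_C, hH, hP1, map_mul, map_pow,
      ← hp, mul_pow, hm]
    ring

lemma FinComp.of_fiber {X ι : Type*} [TopologicalSpace X] [Finite ι] (S : Set X) (g : X → ι)
    (h : ∀ x ∈ S, ∀ y ∈ S, g x = g y → JoinedIn S x y) : FinComp S := by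
  classical
  refine ⟨(fun i : ι => if h : ∃ x ∈ S, g x = i then {h.choose} else (∅ : Set X)) |> fun F => ⋃ i, F i,
    ?_, ?_⟩
  · apply Set.finite_iUnion
    intro i
    split_ifs <;> simp
  · intro x hx
    have hex : ∃ y ∈ S, g y = g x := ⟨x, hx, rfl⟩
    refine ⟨hex.choose, ?_, h _ hx _ hex.choose_spec.1 hex.choose_spec.2.symm⟩
    refine mem_iUnion.2 ⟨g x, ?_⟩
    rw [dif_pos hex]; rfl

lemma finComp_poly (p : Polynomial ℝ) (hp : p ≠ 0) : FinComp {t : ℝ | p.eval t ≠ 0} := by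
  classical
  refine FinComp.of_fiber _ (fun t => (⟨p.roots.toFinset.filter (· < t), by
    simp [Finset.filter_subset]⟩ : {s // s ∈ p.roots.toFinset.powerset})) ?_
  intro x hx y hy h
  wlog hxy : x ≤ y generalizing x y
  · exact (this y hy x hx h.symm (le_of_not_ge hxy)).symm
  apply JoinedIn.of_segment_subset
  rw [segment_eq_Icc hxy]
  intro t ht h0
  have h1 : p.roots.toFinset.filter (· < x) = p.roots.toFinset.filter (· < y) := congrArg Subtype.val h
  have hty : t ≠ y := fun e => hy (e ▸ h0)
  have h2 : t ∈ p.roots.toFinset.filter (· < y) := by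
    simp [hp, h0, lt_of_le_of_ne ht.2 hty]
  rw [← h1] at h2
  exact absurd (Finset.mem_filter.1 h2).2 (not_lt.2 ht.1)

lemma FinComp.of_dense {X : Type*} [NormedAddCommGroup X] [NormedSpace ℝ X] {S S' : Set X}
    (hS : IsOpen S) (hsub : S' ⊆ S) (hd : Dense S') (h : FinComp S') : FinComp S := by
  obtain ⟨A, hA, h⟩ := h
  refine ⟨A, hA, fun x hx => ?_⟩
  obtain ⟨r, hr, hball⟩ := Metric.isOpen_iff.1 hS x hx
  obtain ⟨y, hy, hyx⟩ := hd.exists_dist_lt x hr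
  obtain ⟨a, ha, hj⟩ := h y hy
  refine ⟨a, ha, JoinedIn.trans ?_ (hj.mono hsub)⟩
  apply JoinedIn.of_segment_subset
  refine ((convex_ball x r).segment_subset (Metric.mem_ball_self hr) ?_).trans hball
  rwa [Metric.mem_ball, dist_comm]

lemma FinComp.image {X Y : Type*} [TopologicalSpace X] [TopologicalSpace Y] {S : Set X}
    (h : FinComp S) (g : X → Y) (hg : Continuous g) : FinComp (g '' S) := by
  obtain ⟨A, hA, h⟩ := h
  refine ⟨g '' A, hA.image g, ?_⟩
  rintro _ ⟨x, hx, rfl⟩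
  obtain ⟨a, ha, hj⟩ := h x hx
  exact ⟨g a, mem_image_of_mem g ha, hj.map hg⟩

lemma dense_ne {n : ℕ} (P : MvPolynomial (Fin n) ℝ) (hP : P ≠ 0) :
    Dense {x : Fin n → ℝ | eval x P ≠ 0} := by
  rw [Metric.dense_iff]
  intro x r hr
  by_contra hne
  apply hP
  refine MvPolynomial.funext_set (fun i => Metric.ball (x i) r) (fun i => ?_) ?_
  · rw [Real.ball_eq_Ioo]; exact Set.Ioo_infinite (by linarith)
  · intro y hy
    rw [map_zero]
    by_contra h0
    apply hne
    refine ⟨y, ?_, h0⟩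
    rw [ball_pi _ hr]; exact hy

/-- joint evaluation -/
noncomputable def ev {n : ℕ} (P : Polynomial (MvPolynomial (Fin n) ℝ)) (z : (Fin n → ℝ) × ℝ) : ℝ :=
  (P.map (eval z.1)).eval z.2

lemma ev_cons {n : ℕ} (P : MvPolynomial (Fin (n+1)) ℝ) (z : (Fin n → ℝ) × ℝ) :
    eval (Fin.cons z.2 z.1 : Fin (n+1) → ℝ) P = ev (finSuccEquiv ℝ n P) z :=
  MvPolynomial.eval_eq_eval_mv_eval' _ _ _

lemma cons_cont {n : ℕ} :
    Continuous (fun z : (Fin n → ℝ) × ℝ => (Fin.cons z.2 z.1 : Fin (n+1) → ℝ)) := by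
  fun_prop

lemma ev_cont {n : ℕ} (P : Polynomial (MvPolynomial (Fin n) ℝ)) : Continuous (ev P) := by
  have : ev P = fun z => eval (Fin.cons z.2 z.1 : Fin (n+1) → ℝ) ((finSuccEquiv ℝ n).symm P) := by
    funext z
    rw [ev_cons]; simp
  rw [this]
  exact (MvPolynomial.continuous_eval _).comp cons_cont

lemma ev_deriv {n : ℕ} (P : Polynomial (MvPolynomial (Fin n) ℝ)) (x : Fin n → ℝ) (t : ℝ) :
    HasDerivAt (fun t => ev P (x, t)) (ev (Polynomial.derivative P) (x, t)) t := by
  simp only [ev, ← Polynomial.derivative_map]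
  exact Polynomial.hasDerivAt _ _

/-- Root bound, uniform near `x0`. -/
lemma root_bound {n : ℕ} (P : Polynomial (MvPolynomial (Fin n) ℝ)) (x0 : Fin n → ℝ)
    (h0 : eval x0 P.leadingCoeff ≠ 0) :
    ∃ M : ℝ, ∀ᶠ x in 𝓝 x0, ∀ t, ev P (x, t) = 0 → t ∈ Icc (-M) M := by
  let b : (Fin n → ℝ) → ℝ := fun x =>
    (∑ i ∈ Finset.range P.natDegree, ‖eval x (P.coeff i)‖) / ‖eval x P.leadingCoeff‖ + 1
  have hb : ContinuousAt b x0 := by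
    refine ContinuousAt.add (ContinuousAt.div ?_ ?_ (by simpa using h0)) continuousAt_const
    · exact (continuous_finsetSum _ fun i _ =>
        (MvPolynomial.continuous_eval (P.coeff i)).norm).continuousAt
    · exact (MvPolynomial.continuous_eval P.leadingCoeff).norm.continuousAt
  have hne : ∀ᶠ x in 𝓝 x0, eval x P.leadingCoeff ≠ 0 :=
    (MvPolynomial.continuous_eval P.leadingCoeff).continuousAt.eventually_ne h0
  refine ⟨b x0 + 1, ?_⟩
  filter_upwards [hne, hb.eventually_lt continuousAt_const (lt_add_one (b x0))] with x hx hbx t ht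
  have hp0 : P.map (eval x) ≠ 0 := by
    intro h
    apply hx
    have := congrArg (fun q => Polynomial.coeff q P.natDegree) h
    simpa using this
  have hdeg : (P.map (eval x)).natDegree = P.natDegree :=
    Polynomial.natDegree_map_of_leadingCoeff_ne_zero _ hx
  have h1 := Polynomial.IsRoot.norm_lt_cauchyBound hp0 (show Polynomial.IsRoot _ t from ht)
  have h2 : ((P.map (eval x)).cauchyBound : ℝ) ≤ b x := by
    have : (P.map (eval x)).cauchyBound ≤
        (∑ i ∈ Finset.range P.natDegree, ‖eval x (P.coeff i)‖₊) / ‖eval x P.leadingCoeff‖₊ + 1 := by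
      unfold Polynomial.cauchyBound
      rw [hdeg, Polynomial.leadingCoeff_map_of_leadingCoeff_ne_zero _ hx]
      gcongr
      apply Finset.sup_le
      intro i hi
      rw [Polynomial.coeff_map]
      exact Finset.single_le_sum (f := fun i => ‖eval x (P.coeff i)‖₊) (fun _ _ => zero_le) hi
    have := NNReal.coe_le_coe.2 this
    simpa [b] using this
  have h3 : |t| < (P.map (eval x)).cauchyBound := h1
  rw [mem_Icc, ← abs_le]
  linarith

lemma joined_horiz {n : ℕ} {S : Set ((Fin n → ℝ) × ℝ)} {N : Set (Fin n → ℝ)} (hN : Convex ℝ N)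
    {x y : Fin n → ℝ} (hx : x ∈ N) (hy : y ∈ N) (t : ℝ) (h : ∀ z ∈ N, (z, t) ∈ S) :
    JoinedIn S (x, t) (y, t) := by
  have h1 := (JoinedIn.of_segment_subset (hN.segment_subset hx hy)).map
    (f := fun z => (z, t)) (by fun_prop)
  exact h1.mono (by rintro _ ⟨z, hz, rfl⟩; exact h z hz)

lemma joined_vert {n : ℕ} {S : Set ((Fin n → ℝ) × ℝ)} (x : Fin n → ℝ) {s t : ℝ} (hst : s ≤ t)
    (h : ∀ u ∈ Icc s t, (x, u) ∈ S) : JoinedIn S (x, s) (x, t) := by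
  have h1 := (JoinedIn.of_segment_subset (segment_eq_Icc hst).subset).map
    (f := fun u => (x, u)) (by fun_prop)
  exact h1.mono (by rintro _ ⟨z, hz, rfl⟩; exact h z hz)

/-- local lemma -/
lemma local_lift {n : ℕ} (P A B : Polynomial (MvPolynomial (Fin n) ℝ)) (c Q : MvPolynomial (Fin n) ℝ)
    (hc : A * P + B * Polynomial.derivative P = Polynomial.C c) (x0 : Fin n → ℝ)
    (hl0 : eval x0 P.leadingCoeff ≠ 0) (hc0 : eval x0 c ≠ 0) (hQ0 : eval x0 Q ≠ 0) :
    ∀ᶠ x in 𝓝 x0, ∀ t, ev P (x, t) ≠ 0 →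
      ∃ t0, JoinedIn {z | ev P z ≠ 0 ∧ eval z.1 Q ≠ 0} (x, t) (x0, t0) := by
  obtain ⟨M, hM⟩ := root_bound P x0 hl0
  have hQ : ∀ᶠ x in 𝓝 x0, eval x Q ≠ 0 :=
    (MvPolynomial.continuous_eval Q).continuousAt.eventually_ne hQ0
  have hcpt : ∀ᶠ x in 𝓝 x0, ∀ t ∈ Icc (-M) M, ev P (x, t) ≠ 0 →
      ∃ t0, JoinedIn {z | ev P z ≠ 0 ∧ eval z.1 Q ≠ 0} (x, t) (x0, t0) := by
    refine isCompact_Icc.eventually_forall_of_forall_eventually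
      (P := fun x t => ev P (x, t) ≠ 0 →
        ∃ t0, JoinedIn {z | ev P z ≠ 0 ∧ eval z.1 Q ≠ 0} (x, t) (x0, t0)) ?_
    intro t1 _
    by_cases hF : ev P (x0, t1) = 0
    · have hG : ev (Polynomial.derivative P) (x0, t1) ≠ 0 := by
        intro hG
        apply hc0
        have := congrArg (fun p => ev p (x0, t1)) hc
        simp only [ev, Polynomial.map_add, Polynomial.map_mul, Polynomial.eval_add,
          Polynomial.eval_mul, Polynomial.map_C, Polynomial.eval_C] at this hF hG
        rw [hF, hG] at this
        simpa using this.symm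
      have hev := (ev_cont (Polynomial.derivative P)).continuousAt.eventually_ne hG
      obtain ⟨r, hr, hball⟩ := Metric.eventually_nhds_iff_ball.1 hev
      -- G ≠ 0 on the ball of radius r
      have hG' : ∀ x t, dist x x0 < r → |t - t1| < r → ev (Polynomial.derivative P) (x, t) ≠ 0 := by
        intro x t hx ht
        apply hball
        rw [Metric.mem_ball, Prod.dist_eq]
        exact max_lt hx ht
      have rolle : ∀ x, dist x x0 < r → ∀ s t, s < t → |s - t1| < r → |t - t1| < r →
          ev P (x, s) = 0 → ev P (x, t) = 0 → False := by
        intro x hx s t hst hs ht h1 h2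
        obtain ⟨u, hu, h⟩ := exists_hasDerivAt_eq_zero hst
          (fun u _ => (ev_deriv P x u).continuousAt.continuousWithinAt) (h1.trans h2.symm)
          (fun u _ => ev_deriv P x u)
        refine hG' x u hx ?_ h
        rw [abs_lt] at *
        constructor <;> linarith [hu.1, hu.2]
      have hr2 : |t1 + r/2 - t1| < r := by rw [abs_lt]; constructor <;> linarith
      have hr2' : |t1 - r/2 - t1| < r := by rw [abs_lt]; constructor <;> linarith
      have hr1 : |t1 - t1| < r := by simpa using hr
      have hx00 : dist x0 x0 < r := by simpa using hr
      have hp : ev P (x0, t1 + r/2) ≠ 0 := fun h =>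
        rolle x0 hx00 t1 (t1 + r/2) (by linarith) hr1 hr2 hF h
      have hm : ev P (x0, t1 - r/2) ≠ 0 := fun h =>
        rolle x0 hx00 (t1 - r/2) t1 (by linarith) hr2' hr1 h hF
      have hp' : ∀ᶠ x in 𝓝 x0, ev P (x, t1 + r/2) ≠ 0 :=
        ((ev_cont P).comp (by fun_prop : Continuous fun x => (x, t1 + r/2))).continuousAt.eventually_ne hp
      have hm' : ∀ᶠ x in 𝓝 x0, ev P (x, t1 - r/2) ≠ 0 :=
        ((ev_cont P).comp (by fun_prop : Continuous fun x => (x, t1 - r/2))).continuousAt.eventually_ne hm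
      obtain ⟨δ, hδ, hN⟩ := Metric.eventually_nhds_iff_ball.1 (hp'.and (hm'.and hQ))
      have hnear : ∀ᶠ z : (Fin n → ℝ) × ℝ in 𝓝 (x0, t1), dist z (x0, t1) < min δ (r/2) :=
        Metric.ball_mem_nhds _ (lt_min hδ (by linarith))
      filter_upwards [hnear] with z hz hne
      obtain ⟨x, t⟩ := z
      rw [Prod.dist_eq, max_lt_iff, lt_min_iff, lt_min_iff] at hz
      obtain ⟨⟨hx1, hx2⟩, -, ht⟩ := hz
      simp only at hx1 hx2 ht hne
      rw [Real.dist_eq] at ht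
      have hxr : dist x x0 < r := by linarith
      have hxm : x ∈ Metric.ball x0 δ := hx1
      have hx0m : x0 ∈ Metric.ball x0 δ := Metric.mem_ball_self hδ
      have ht' := abs_lt.1 ht
      by_cases hup : ∀ u ∈ Icc t (t1 + r/2), ev P (x, u) ≠ 0
      · refine ⟨t1 + r/2, (joined_vert x (by linarith) ?_).trans
          (joined_horiz (convex_ball x0 δ) hxm hx0m _ ?_)⟩
        · exact fun u hu => ⟨hup u hu, (hN x hxm).2.2⟩
        · exact fun y hy => ⟨(hN y hy).1, (hN y hy).2.2⟩
      · push Not at hup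
        obtain ⟨u, hu, hu0⟩ := hup
        refine ⟨t1 - r/2, (joined_vert x (by linarith) ?_).symm.trans
          (joined_horiz (convex_ball x0 δ) hxm hx0m _ ?_)⟩
        · refine fun v hv => ⟨fun hv0 => ?_, (hN x hxm).2.2⟩
          have hvt : v < t := lt_of_le_of_ne hv.2 (fun e => hne (e ▸ hv0))
          refine rolle x hxr v u (lt_of_lt_of_le hvt hu.1) ?_ ?_ hv0 hu0
          · rw [abs_lt]; constructor <;> linarith [hv.1]
          · rw [abs_lt]; constructor <;> linarith [hu.1, hu.2]
        · exact fun y hy => ⟨(hN y hy).2.1, (hN y hy).2.2⟩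
    · have hev := (ev_cont P).continuousAt.eventually_ne hF
      have hQ' : ∀ᶠ z : (Fin n → ℝ) × ℝ in 𝓝 (x0, t1), eval z.1 Q ≠ 0 :=
        ((MvPolynomial.continuous_eval Q).comp continuous_fst).continuousAt.eventually_ne hQ0
      obtain ⟨r, hr, hball⟩ := Metric.eventually_nhds_iff_ball.1 (hev.and hQ')
      filter_upwards [Metric.ball_mem_nhds _ hr] with z hz _
      obtain ⟨x, t⟩ := z
      rw [Metric.mem_ball, Prod.dist_eq, max_lt_iff] at hz
      refine ⟨t, joined_horiz (convex_ball x0 r) hz.1 (Metric.mem_ball_self hr) _ ?_⟩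
      intro y hy
      apply hball
      rw [Metric.mem_ball, Prod.dist_eq]
      exact max_lt hy hz.2
  obtain ⟨δ, hδ, hN⟩ := Metric.eventually_nhds_iff_ball.1 (hcpt.and (hM.and hQ))
  filter_upwards [Metric.ball_mem_nhds _ hδ] with x hx t ht
  by_cases htM : t ∈ Icc (-M) M
  · exact (hN x hx).1 t htM ht
  · refine ⟨t, joined_horiz (convex_ball x0 δ) hx (Metric.mem_ball_self hδ) _ ?_⟩
    exact fun y hy => ⟨fun h => htM ((hN y hy).2.1 t h), (hN y hy).2.2⟩

lemma step {n : ℕ} (P A B : Polynomial (MvPolynomial (Fin n) ℝ)) (c : MvPolynomial (Fin n) ℝ)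
    (hc : A * P + B * Polynomial.derivative P = Polynomial.C c)
    (ih : FinComp {x : Fin n → ℝ | eval x (c * P.leadingCoeff) ≠ 0}) :
    FinComp {z : (Fin n → ℝ) × ℝ | ev P z ≠ 0 ∧ eval z.1 (c * P.leadingCoeff) ≠ 0} := by
  set Q := c * P.leadingCoeff with hQdef
  set S := {z : (Fin n → ℝ) × ℝ | ev P z ≠ 0 ∧ eval z.1 Q ≠ 0} with hS
  have hSo : IsOpen S := (isOpen_ne_fun (ev_cont P) continuous_const).inter
    (isOpen_ne_fun ((MvPolynomial.continuous_eval Q).comp continuous_fst) continuous_const)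
  obtain ⟨A', hA', hj'⟩ := ih
  have hsplit : ∀ x, eval x Q ≠ 0 → eval x c ≠ 0 ∧ eval x P.leadingCoeff ≠ 0 := by
    intro x hx
    rw [hQdef, map_mul] at hx
    exact ⟨left_ne_zero_of_mul hx, right_ne_zero_of_mul hx⟩
  have hfib : ∀ a : Fin n → ℝ, ∃ T : Set ℝ, T.Finite ∧ (eval a Q ≠ 0 →
      ∀ t, ev P (a, t) ≠ 0 → ∃ s ∈ T, JoinedIn S (a, t) (a, s)) := by
    intro a
    by_cases ha : eval a Q = 0
    · exact ⟨∅, Set.finite_empty, fun h => absurd ha h⟩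
    have hp0 : P.map (eval a) ≠ 0 := by
      intro h
      apply (hsplit a ha).2
      have := congrArg (fun q => Polynomial.coeff q P.natDegree) h
      simpa using this
    obtain ⟨T, hT, hj⟩ := finComp_poly _ hp0
    refine ⟨T, hT, fun _ t ht => ?_⟩
    obtain ⟨s, hs, h⟩ := hj t ht
    refine ⟨s, hs, (h.map (f := fun t => (a, t)) (by fun_prop)).mono ?_⟩
    rintro _ ⟨u, hu, rfl⟩
    exact ⟨hu, ha⟩
  choose T hT hTj using hfib
  refine ⟨⋃ a ∈ A', (fun t => (a, t)) '' T a, hA'.biUnion fun a _ => (hT a).image _, ?_⟩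
  rintro ⟨x, t⟩ hxt
  obtain ⟨a, ha, γ, hγ⟩ := hj' x hxt.2
  have hclopen : IsClopen {s : unitInterval | ∃ u, JoinedIn S (x, t) (γ s, u)} := by
    have key : ∀ s, ∀ᶠ s' in 𝓝 s, ∀ u, ev P (γ s', u) ≠ 0 → ∃ u0, JoinedIn S (γ s', u) (γ s, u0) := by
      intro s
      exact (γ.continuous.tendsto s).eventually (local_lift P A B c Q hc (γ s)
        (hsplit _ (hγ s)).2 (hsplit _ (hγ s)).1 (hγ s))
    constructor
    · rw [← isOpen_compl_iff, isOpen_iff_mem_nhds]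
      intro s hs
      filter_upwards [key s] with s' hs'
      rintro ⟨u, hu⟩
      obtain ⟨u0, h0⟩ := hs' u hu.target_mem.1
      exact hs ⟨u0, hu.trans h0⟩
    · rw [isOpen_iff_mem_nhds]
      rintro s ⟨u, hu⟩
      obtain ⟨r, hr, hball⟩ := Metric.isOpen_iff.1 hSo _ hu.target_mem
      have : ∀ᶠ s' in 𝓝 s, γ s' ∈ Metric.ball (γ s) r :=
        (γ.continuous.tendsto s).eventually (Metric.ball_mem_nhds _ hr)
      filter_upwards [this] with s' hs'
      refine ⟨u, hu.trans (joined_horiz (convex_ball (γ s) r) (Metric.mem_ball_self hr) hs' _ ?_)⟩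
      intro y hy
      apply hball
      rw [Metric.mem_ball, Prod.dist_eq]
      exact max_lt hy (by simpa using hr)
  have huniv := hclopen.eq_univ ⟨0, t, by rw [γ.source]; exact JoinedIn.refl hxt⟩
  obtain ⟨u, hu⟩ : ∃ u, JoinedIn S (x, t) (γ 1, u) := by
    have : (1 : unitInterval) ∈ {s : unitInterval | ∃ u, JoinedIn S (x, t) (γ s, u)} := by
      rw [huniv]; trivial
    exact this
  rw [γ.target] at hu
  obtain ⟨s, hs, h⟩ := hTj a hu.target_mem.2 u hu.target_mem.1
  exact ⟨(a, s), mem_biUnion ha (mem_image_of_mem _ hs), hu.trans h⟩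

theorem finComp_mv (n : ℕ) : ∀ P : MvPolynomial (Fin n) ℝ, P ≠ 0 →
    FinComp {x : Fin n → ℝ | eval x P ≠ 0} := by
  induction n with
  | zero =>
    intro P _
    refine ⟨univ, Set.finite_univ, fun x hx => ⟨x, mem_univ _, JoinedIn.refl hx⟩⟩
  | succ n ih =>
    intro P hP
    have hP' : finSuccEquiv ℝ n P ≠ 0 := by simpa using hP
    obtain ⟨P1, A, B, H, c, m, hP1, hc0, hc, hH⟩ := alg (finSuccEquiv ℝ n P) hP'
    have hl : c * P1.leadingCoeff ≠ 0 := mul_ne_zero hc0 (by simpa using hP1)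
    have h1 := (step P1 A B c hc (ih _ hl)).image _ cons_cont
    refine FinComp.of_dense ?_ ?_ ?_ h1
    · exact isOpen_ne_fun (MvPolynomial.continuous_eval P) continuous_const
    · rintro _ ⟨z, ⟨hz1, hz2⟩, rfl⟩ h0
      replace h0 : eval (Fin.cons z.2 z.1 : Fin (n+1) → ℝ) P = 0 := h0
      rw [ev_cons] at h0
      rw [map_mul] at hz2
      have := congrArg (fun p => ev p z) hH
      simp only [ev, Polynomial.map_mul, Polynomial.map_pow, Polynomial.eval_mul,
          Polynomial.eval_pow, Polynomial.map_C, Polynomial.eval_C] at this h0 hz1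
      rw [h0, zero_mul] at this
      exact mul_ne_zero (left_ne_zero_of_mul hz2) (pow_ne_zero _ hz1) this
    · let P2 := (finSuccEquiv ℝ n).symm (P1 * Polynomial.C (c * P1.leadingCoeff))
      have hP2 : P2 ≠ 0 := by
        simp only [P2, ne_eq, EmbeddingLike.map_eq_zero_iff]
        exact mul_ne_zero hP1 (by simpa using hl)
      refine (dense_ne P2 hP2).mono ?_
      intro x hx
      have hxc : x = Fin.cons (x 0, Fin.tail x).1 (x 0, Fin.tail x).2 := (Fin.cons_self_tail x).symm
      refine ⟨(Fin.tail x, x 0), ?_, hxc.symm⟩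
      have hx' : eval x P2 ≠ 0 := hx
      have h3 : eval x P2 = ev (P1 * Polynomial.C (c * P1.leadingCoeff)) (Fin.tail x, x 0) := by
        have := ev_cons P2 (Fin.tail x, x 0)
        rw [Fin.cons_self_tail] at this
        rw [this]; simp [P2]
      rw [h3] at hx'
      simp only [ev, Polynomial.map_mul, Polynomial.eval_mul, Polynomial.map_C,
        Polynomial.eval_C] at hx'
      exact ⟨left_ne_zero_of_mul hx', right_ne_zero_of_mul hx'⟩

lemma FinComp.finite {X : Type*} [TopologicalSpace X] {S : Set X} (h : FinComp S) :
    Finite (ConnectedComponents S) := by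
  obtain ⟨A, hA, h⟩ := h
  have hfin : ((Subtype.val : S → X) ⁻¹' A).Finite := hA.preimage Subtype.val_injective.injOn
  haveI := hfin.to_subtype
  refine Finite.of_surjective
    (fun a : ((Subtype.val : S → X) ⁻¹' A) => (ConnectedComponents.mk a.1)) ?_
  intro q
  obtain ⟨x, rfl⟩ := ConnectedComponents.surjective_coe q
  obtain ⟨a, ha, hj⟩ := h x x.2
  refine ⟨⟨⟨a, hj.target_mem⟩, ha⟩, ?_⟩
  obtain ⟨γ⟩ := hj.joined_subtype
  have hpre : IsPreconnected (range γ) := isPreconnected_range γ.continuous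
  refine (ConnectedComponents.coe_eq_coe'.2 ?_).symm
  refine hpre.subset_connectedComponent (x := ⟨a, hj.target_mem⟩) ⟨1, γ.target⟩ ⟨0, γ.source⟩

lemma cross {X : Type*} [TopologicalSpace X] (g : X → ℝ) (hg : Continuous g) (e : ℝ)
    (hne : ∀ x, g x ≠ e) {x y : X} (h : (x : ConnectedComponents X) = y) (hx : g x < e) : g y < e := by
  by_contra hy
  push Not at hy
  have hpre : IsPreconnected (connectedComponent y) := isPreconnected_connectedComponent
  obtain ⟨z, -, hz⟩ := hpre.intermediate_value (ConnectedComponents.coe_eq_coe'.1 h)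
    mem_connectedComponent hg.continuousOn ⟨hx.le, hy⟩
  exact hne z hz

end SignAux

open MvPolynomial

/-- For polynomials `f₁, …, f_k ∈ ℝ[X_1, …, X_n]` there is `ε > 0` such that the number of
distinct consistent sign assignments for `f₁, …, f_k` (strings `σ ∈ {<, =, >}^k` realized by
some point of `ℝ^n`) is at most the number of connected components of the open set
`S = {x : ∏_{i=1}^k (f_i(x) + ε)² (f_i(x) − ε)² > 0}`. -/
theorem sign_assignments_le_components (n k : ℕ)
    (f : Fin k → MvPolynomial (Fin n) ℝ) :
    ∃ ε : ℝ, 0 < ε ∧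
      Nat.card {σ : Fin k → SignType |
          ∃ x : Fin n → ℝ, ∀ i, SignType.sign (eval x (f i)) = σ i} ≤
        Nat.card (ConnectedComponents
          {x : Fin n → ℝ //
            0 < ∏ i, (eval x (f i) + ε) ^ 2 * (eval x (f i) - ε) ^ 2}) := by
  classical
  set Sg := {σ : Fin k → SignType |
          ∃ x : Fin n → ℝ, ∀ i, SignType.sign (eval x (f i)) = σ i} with hSg
  have hw : ∀ σ : Sg, ∃ x : Fin n → ℝ, ∀ i, SignType.sign (eval x (f i)) = σ.1 i := fun σ => σ.2
  choose w hw using hw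
  haveI : Nonempty Sg := ⟨⟨fun i => SignType.sign (eval 0 (f i)), 0, fun i => rfl⟩⟩
  obtain ⟨ε, hε, hlt⟩ : ∃ ε : ℝ, 0 < ε ∧ ∀ (σ : Sg) (i : Fin k), eval (w σ) (f i) ≠ 0 →
      ε < |eval (w σ) (f i)| := by
    have h : ∀ᶠ ε in nhdsWithin (0 : ℝ) (Set.Ioi 0), ∀ (σ : Sg) (i : Fin k),
        eval (w σ) (f i) ≠ 0 → ε < |eval (w σ) (f i)| := by
      rw [Filter.eventually_all]
      intro σ
      rw [Filter.eventually_all]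
      intro i
      by_cases h0 : eval (w σ) (f i) = 0
      · simp [h0]
      · filter_upwards [Ioo_mem_nhdsGT (abs_pos.2 h0)] with ε hε _ using hε.2
    obtain ⟨ε, h1, h2⟩ := (h.and self_mem_nhdsWithin).exists
    exact ⟨ε, h2, h1⟩
  refine ⟨ε, hε, ?_⟩
  have hmem : ∀ x : Fin n → ℝ, 0 < ∏ i, (eval x (f i) + ε) ^ 2 * (eval x (f i) - ε) ^ 2 ↔
      ∀ i, eval x (f i) ≠ -ε ∧ eval x (f i) ≠ ε := by
    intro x
    have hnn : 0 ≤ ∏ i, (eval x (f i) + ε) ^ 2 * (eval x (f i) - ε) ^ 2 :=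
      Finset.prod_nonneg fun i _ => by positivity
    rw [hnn.lt_iff_ne', Finset.prod_ne_zero_iff]
    simp [sub_eq_zero, add_eq_zero_iff_eq_neg]
  have hws : ∀ σ : Sg, 0 < ∏ i, (eval (w σ) (f i) + ε) ^ 2 * (eval (w σ) (f i) - ε) ^ 2 := by
    intro σ
    rw [hmem]
    intro i
    by_cases h0 : eval (w σ) (f i) = 0
    · rw [h0]; constructor <;> intro h <;> linarith
    · have := hlt σ i h0
      constructor <;> intro h <;> rw [h] at this <;> simp [abs_of_pos hε] at this
  let P : MvPolynomial (Fin n) ℝ := ∏ i, (f i + C ε) ^ 2 * (f i - C ε) ^ 2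
  have hPe : ∀ x, eval x P = ∏ i, (eval x (f i) + ε) ^ 2 * (eval x (f i) - ε) ^ 2 := by
    intro x; simp [P, map_prod]
  have hP0 : P ≠ 0 := by
    intro h
    obtain ⟨σ⟩ := ‹Nonempty Sg›
    have h1 := hws σ
    rw [← hPe, h] at h1
    simp at h1
  have hset : {x : Fin n → ℝ | eval x P ≠ 0} =
      {x : Fin n → ℝ | 0 < ∏ i, (eval x (f i) + ε) ^ 2 * (eval x (f i) - ε) ^ 2} := by
    ext x
    have hnn : 0 ≤ ∏ i, (eval x (f i) + ε) ^ 2 * (eval x (f i) - ε) ^ 2 :=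
      Finset.prod_nonneg fun i _ => by positivity
    simp only [Set.mem_setOf_eq]
    rw [hPe, hnn.lt_iff_ne']
  have hfc := SignAux.finComp_mv n P hP0
  rw [hset] at hfc
  haveI : Finite (ConnectedComponents {x : Fin n → ℝ //
      0 < ∏ i, (eval x (f i) + ε) ^ 2 * (eval x (f i) - ε) ^ 2}) := hfc.finite
  refine Nat.card_le_card_of_injective
    (fun σ : Sg => (ConnectedComponents.mk (⟨w σ, hws σ⟩ : {x : Fin n → ℝ //
      0 < ∏ i, (eval x (f i) + ε) ^ 2 * (eval x (f i) - ε) ^ 2}))) ?_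
  -- one direction of each comparison
  have hdir : ∀ σ τ : Sg, (ConnectedComponents.mk (⟨w σ, hws σ⟩ : {x : Fin n → ℝ //
      0 < ∏ i, (eval x (f i) + ε) ^ 2 * (eval x (f i) - ε) ^ 2})) =
      ConnectedComponents.mk ⟨w τ, hws τ⟩ → ∀ i,
      (eval (w σ) (f i) < 0 → eval (w τ) (f i) < 0) ∧
      (eval (w σ) (f i) ≤ 0 → eval (w τ) (f i) ≤ 0) := by
    intro σ τ h i
    have hcont : Continuous (fun x : {x : Fin n → ℝ //
      0 < ∏ i, (eval x (f i) + ε) ^ 2 * (eval x (f i) - ε) ^ 2} => eval x.1 (f i)) :=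
      (MvPolynomial.continuous_eval (f i)).comp continuous_subtype_val
    constructor
    · intro hs
      have h1 := hlt σ i hs.ne
      rw [abs_of_neg hs] at h1
      have := SignAux.cross _ hcont (-ε) (fun x => ((hmem x.1).1 x.2 i).1) h
        (show eval (w σ) (f i) < -ε by linarith)
      have : eval (w τ) (f i) < -ε := this
      linarith
    · intro hs
      have := SignAux.cross _ hcont ε (fun x => ((hmem x.1).1 x.2 i).2) h
        (show eval (w σ) (f i) < ε by linarith)
      have : eval (w τ) (f i) < ε := this
      by_contra hτ
      push Not at hτ
      have h1 := hlt τ i hτ.ne'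
      rw [abs_of_pos hτ] at h1
      linarith
  intro σ τ h
  apply Subtype.ext
  funext i
  rw [← hw σ i, ← hw τ i]
  have h1 := hdir σ τ h i
  have h2 := hdir τ σ h.symm i
  rcases lt_trichotomy (eval (w σ) (f i)) 0 with hs | hs | hs
  · rw [sign_neg hs, sign_neg (h1.1 hs)]
  · have h3 : eval (w τ) (f i) = 0 := by
      apply le_antisymm (h1.2 hs.le)
      by_contra hh
      push Not at hh
      linarith [h2.1 hh]
    rw [hs, h3]
  · have h3 : 0 < eval (w τ) (f i) := by
      by_contra hh
      push Not at hh
      linarith [h2.2 hh]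
    rw [sign_pos hs, sign_pos h3]
end

section
/- Let L(u) = Σ_{j=0}^n η_j u_j be a nonzero linear form on ℝ^{n+1}, let Q ∈ ℝ[U_0, …, U_n], let p ≥ 1, and set R = L^p · Q. Let α, β ∈ ℝ^{n+1} and t' ∈ ℝ be such that L(αt' + β) = 0 and L(α) ≠ 0. Then for every j ∈ {0, …, n}, the mixed partial derivative ∂^p/(∂s ∂t^{p−1}) of the two-variable polynomial (t, s) ↦ R(αt + s·e_j + β), evaluated at t = t' and s = 0, equals p! · L(α)^{p−1} · η_j · Q(αt' + β); here e_j denotes the j-th standard basis vector of ℝ^{n+1}. In particular, if Q(αt' + β) ≠ 0, these derivatives are proportional to the coefficient vector (η_0, …, η_n) of L. -/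
open MvPolynomial

lemma hasDerivAt_eval_line_aux {n : ℕ} (γ δ : Fin (n + 1) → ℝ)
    (P : MvPolynomial (Fin (n + 1)) ℝ) (t : ℝ) :
    HasDerivAt (fun t : ℝ => eval (fun i => γ i * t + δ i) P)
      (eval (fun i => γ i * t + δ i) (mkDerivation ℝ (fun i => C (γ i)) P)) t := by
  induction P using MvPolynomial.induction_on with
  | C a =>
    rw [derivation_C]
    simpa using hasDerivAt_const t a
  | add p q hp hq =>
    simp only [map_add]
    exact hp.add hq
  | mul_X p i hp =>
    simp only [Derivation.leibniz, mkDerivation_X, map_add, map_mul, eval_X, smul_eq_mul, eval_C]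
    have h : HasDerivAt (fun t : ℝ => γ i * t + δ i) (γ i) t := by
      simpa using ((hasDerivAt_id t).const_mul (γ i)).add_const (δ i)
    refine (hp.mul h).congr_deriv ?_
    ring

lemma iteratedDeriv_eval_line_aux {n : ℕ} (γ δ : Fin (n + 1) → ℝ) (k : ℕ) :
    ∀ (P : MvPolynomial (Fin (n + 1)) ℝ),
    iteratedDeriv k (fun t : ℝ => eval (fun i => γ i * t + δ i) P) =
      fun t => eval (fun i => γ i * t + δ i) ((mkDerivation ℝ (fun i => C (γ i)))^[k] P) := by
  induction k with
  | zero => intro P; simp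
  | succ k ih =>
    intro P
    rw [iteratedDeriv_succ', Function.iterate_succ_apply, ← ih]
    congr 1
    funext t
    exact (hasDerivAt_eval_line_aux γ δ P t).deriv

lemma iterate_derivation_aux {A : Type*} [CommRing A] [Algebra ℝ A] (D : Derivation ℝ A A)
    (L : A) (a : ℝ) (hD : D L = algebraMap ℝ A a) (k : ℕ) :
    ∀ Q : A, ∃ Q' : A, D^[k] (L ^ (k + 1) * Q) =
      L * (algebraMap ℝ A ((k + 1).factorial * a ^ k) * Q + L * Q') := by
  induction k with
  | zero => intro Q; exact ⟨0, by simp⟩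
  | succ k ih =>
    intro Q
    have h1 : D (L ^ (k + 2) * Q) =
        L ^ (k + 1) * (algebraMap ℝ A ((k + 2) * a) * Q + L * D Q) := by
      rw [Derivation.leibniz, Derivation.leibniz_pow, hD]
      simp only [smul_eq_mul, nsmul_eq_mul, map_mul, map_add, map_natCast, map_ofNat]
      push_cast
      ring
    obtain ⟨Q', h⟩ := ih (algebraMap ℝ A ((k + 2) * a) * Q + L * D Q)
    refine ⟨algebraMap ℝ A ((k + 1).factorial * a ^ k) * D Q + Q', ?_⟩
    rw [Function.iterate_succ_apply, h1, h, Nat.factorial_succ (k + 1)]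
    simp only [map_mul, map_add, map_natCast, map_ofNat, map_pow]
    push_cast
    ring

/-- Recovering the coefficients of a repeated linear factor from mixed partial derivatives:
if `R = L^p · Q` with `L(u) = Σ_j η_j u_j` a nonzero linear form, and `t'` satisfies
`L(αt' + β) = 0` with `L(α) ≠ 0`, then for every `j`,
`∂^p/(∂s ∂t^{p−1}) R(αt + s·e_j + β) |_{t = t', s = 0} = p! · L(α)^{p−1} · η_j · Q(αt' + β)`. -/
theorem mixed_partials_of_repeated_linear_factor (n p : ℕ) (hp : 1 ≤ p)
    (η : Fin (n + 1) → ℝ) (hη : η ≠ 0)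
    (L Q R : MvPolynomial (Fin (n + 1)) ℝ)
    (hL : L = ∑ j, C (η j) * X j) (hR : R = L ^ p * Q)
    (α β : Fin (n + 1) → ℝ) (t' : ℝ)
    (ht' : ∑ j, η j * (α j * t' + β j) = 0)
    (hα : ∑ j, η j * α j ≠ 0) :
    ∀ j : Fin (n + 1),
      deriv (fun s : ℝ =>
          iteratedDeriv (p - 1) (fun t : ℝ =>
            eval (fun idx => α idx * t + s * (if idx = j then (1:ℝ) else 0) + β idx) R) t') 0 =
        (p.factorial : ℝ) * (∑ i, η i * α i) ^ (p - 1) * η j *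
          eval (fun idx => α idx * t' + β idx) Q := by
  intro j
  obtain ⟨k, rfl⟩ : ∃ k, p = k + 1 := ⟨p - 1, by omega⟩
  simp only [Nat.add_sub_cancel]
  set a := ∑ i, η i * α i with ha
  have hDL : ∀ γ : Fin (n + 1) → ℝ, mkDerivation ℝ (fun i => (C (γ i) :
      MvPolynomial (Fin (n + 1)) ℝ)) L = algebraMap ℝ _ (∑ i, η i * γ i) := by
    intro γ
    rw [hL, map_sum, map_sum]
    refine Finset.sum_congr rfl fun i _ => ?_
    rw [← smul_eq_C_mul, Derivation.map_smul, mkDerivation_X, smul_eq_C_mul, ← C_mul]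
    rfl
  obtain ⟨Q', hQ'⟩ := iterate_derivation_aux (mkDerivation ℝ (fun i => (C (α i) :
      MvPolynomial (Fin (n + 1)) ℝ))) L a (hDL α) k Q
  rw [← hR] at hQ'
  set γ : Fin (n + 1) → ℝ := fun idx => if idx = j then (1:ℝ) else 0 with hγ
  have hfun : (fun s : ℝ => iteratedDeriv k (fun t : ℝ =>
      eval (fun idx => α idx * t + s * (if idx = j then (1:ℝ) else 0) + β idx) R) t') =
      fun s : ℝ => eval (fun idx => γ idx * s + (α idx * t' + β idx))
        (L * (algebraMap ℝ _ ((k + 1).factorial * a ^ k) * Q + L * Q')) := by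
    funext s
    have := congrFun (iteratedDeriv_eval_line_aux α
      (fun idx => s * (if idx = j then (1:ℝ) else 0) + β idx) k R) t'
    rw [hQ'] at this
    simp only [← add_assoc] at this
    rw [this]
    have hv : (fun idx => α idx * t' + s * (if idx = j then (1:ℝ) else 0) + β idx) =
        fun idx => γ idx * s + (α idx * t' + β idx) := by
      funext idx
      simp only [hγ]
      ring
    rw [hv]
  rw [hfun, (hasDerivAt_eval_line_aux γ (fun idx => α idx * t' + β idx) _ 0).deriv]
  have hL0 : eval (fun idx => α idx * t' + β idx) L = 0 := by
    rw [hL, map_sum]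
    simpa using ht'
  rw [Derivation.leibniz, hDL γ]
  have hs : ∑ i, η i * γ i = η j := by simp [hγ]
  rw [hs]
  simp only [mul_zero, zero_add, smul_eq_mul, map_add, map_mul, hL0, algebraMap_eq, eval_C,
    zero_mul, add_zero]
  ring
end
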